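/- arXiv:2604.01143 — 3 statements merged into one kernel-verified Lean document; each statement's English description precedes it below -/
import Mathlib

section
/- The pair of patterns {1324, 231} is inversion monotone; that is, for every n ≥ 1 and every k ≥ 0, the number of permutations of length n with exactly k inversions avoiding both 1324 and 231 is at most the number of permutations of length n+1 with exactly k inversions avoiding both 1324 and 231. -/
/-- A permutation `π` of length `n` (as a bijection of `Fin n`, position `i` has value `π i`)
contains the pattern `p` of length `m` if some subsequence of `π` is order-isomorphic to `p`. -/
def Contains {n m : ℕ} (π : Equiv.Perm (Fin n)) (p : Equiv.Perm (Fin m)) : Prop :=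
  ∃ f : Fin m → Fin n, StrictMono f ∧ ∀ a b : Fin m, π (f a) < π (f b) ↔ p a < p b

/-- `π` avoids the pattern `p`. -/
def Avoids {n m : ℕ} (π : Equiv.Perm (Fin n)) (p : Equiv.Perm (Fin m)) : Prop :=
  ¬ Contains π p

/-- The number of inversions of `π`: pairs of positions `i < j` with `π i > π j`. -/
noncomputable def invCount {n : ℕ} (π : Equiv.Perm (Fin n)) : ℕ :=
  Nat.card {ij : Fin n × Fin n // ij.1 < ij.2 ∧ π ij.2 < π ij.1}

/-- The pattern 1324 (one-line notation, 0-indexed values). -/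
def p1324 : Equiv.Perm (Fin 4) := ⟨![0,2,1,3], ![0,2,1,3], by decide, by decide⟩

/-- The pattern 231 (one-line notation, 0-indexed values). -/
def p231 : Equiv.Perm (Fin 3) := ⟨![1,2,0], ![2,0,1], by decide, by decide⟩

open Polynomial Finset

/-- Coefficientwise comparison of polynomials with natural coefficients. -/
def CoeffLE (p q : ℕ[X]) : Prop := ∃ r, q = p + r

local infix:50 "≼" => CoeffLE

namespace CoeffLE

variable {p q r p' q' : ℕ[X]}

theorem refl (p : ℕ[X]) : p ≼ p := ⟨0, by simp⟩

theorem trans (h : p ≼ q) (h' : q ≼ r) : p ≼ r := by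
  obtain ⟨a, rfl⟩ := h
  obtain ⟨b, rfl⟩ := h'
  exact ⟨a + b, by ring⟩

theorem add (h : p ≼ q) (h' : p' ≼ q') : p + p' ≼ q + q' := by
  obtain ⟨a, rfl⟩ := h
  obtain ⟨b, rfl⟩ := h'
  exact ⟨a + b, by ring⟩

theorem mul (h : p ≼ q) (h' : p' ≼ q') : p * p' ≼ q * q' := by
  obtain ⟨a, rfl⟩ := h
  obtain ⟨b, rfl⟩ := h'
  exact ⟨p * b + a * p' + a * b, by ring⟩

theorem mul_left (r : ℕ[X]) (h : p ≼ q) : r * p ≼ r * q := (refl r).mul h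

theorem add_left (p q : ℕ[X]) : p ≼ q + p := ⟨q, add_comm _ _⟩

theorem sum {ι : Type*} {s : Finset ι} {f g : ι → ℕ[X]} (h : ∀ i ∈ s, f i ≼ g i) :
    ∑ i ∈ s, f i ≼ ∑ i ∈ s, g i := by
  classical
  induction s using Finset.induction_on with
  | empty => exact refl _
  | insert a s ha ih =>
    rw [sum_insert ha, sum_insert ha]
    exact (h a (mem_insert_self _ _)).add (ih fun i hi => h i (mem_insert_of_mem hi))

theorem coeff_le (h : p ≼ q) (k : ℕ) : p.coeff k ≤ q.coeff k := by
  obtain ⟨a, rfl⟩ := h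
  simp

end CoeffLE

/-- The product `∏ 0 < i < n, (1 + X ^ i)`, the inversion polynomial of both `Av(132, 231)` and
`Av(213, 231)` in length `n`. -/
noncomputable def distinctPoly : ℕ → ℕ[X]
  | 0 => 1
  | 1 => 1
  | n + 2 => (1 + X ^ (n + 1)) * distinctPoly (n + 1)

theorem X_pow_mul_distinctPoly_le (n : ℕ) :
    ∀ i ≤ n, X ^ i * distinctPoly n ≼ distinctPoly (n + 1) := by
  induction n with
  | zero =>
    intro i hi
    obtain rfl : i = 0 := by omega
    simpa [distinctPoly] using CoeffLE.refl 1
  | succ n ih =>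
    intro i hi
    rcases Nat.eq_zero_or_pos i with rfl | h0
    · exact ⟨X ^ (n + 1) * distinctPoly (n + 1), by rw [distinctPoly]; ring⟩
    rcases hi.eq_or_lt with rfl | hlt
    · exact ⟨distinctPoly (n + 1), by rw [distinctPoly]; ring⟩
    obtain ⟨m, rfl⟩ : ∃ m, n = m + 1 := ⟨n - 1, by omega⟩
    obtain ⟨j, rfl⟩ : ∃ j, i = j + 1 := ⟨i - 1, by omega⟩
    have h1 := ih (j + 1) (by omega)
    have h2 := (ih j (by omega)).mul_left (X ^ (m + 2))
    have h := h1.add h2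
    convert h using 1
    · rw [distinctPoly]; ring
    · rw [distinctPoly]; ring

/-- The inversion polynomial of the permutations in `Av(1324, 231)` of length `n + 2`
that do not start with their maximum. -/
noncomputable def splitPoly (n : ℕ) : ℕ[X] :=
  ∑ x ∈ antidiagonal n, distinctPoly (x.1 + 1) * distinctPoly x.2 * X ^ x.2

/-- The convolution obtained from `splitPoly` by dropping the powers of `X`. -/
noncomputable def convPoly (n : ℕ) : ℕ[X] :=
  ∑ x ∈ antidiagonal n, distinctPoly (x.1 + 1) * distinctPoly x.2

theorem splitPoly_succ (n : ℕ) :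
    splitPoly (n + 1) = splitPoly n + X ^ (n + 1) * (distinctPoly (n + 1) + convPoly n) := by
  have h : ∑ x ∈ antidiagonal n, distinctPoly (x.1 + 1 + 1) * distinctPoly x.2 * X ^ x.2 =
      splitPoly n + X ^ (n + 1) * convPoly n := by
    rw [splitPoly, convPoly, mul_sum, ← sum_add_distrib]
    refine sum_congr rfl fun x hx => ?_
    rw [← mem_antidiagonal.1 hx, distinctPoly]
    ring
  rw [splitPoly, Finset.Nat.sum_antidiagonal_succ, h]
  simp only [distinctPoly]
  ring

theorem splitPoly_le_succ (n : ℕ) : splitPoly n ≼ splitPoly (n + 1) :=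
  ⟨_, splitPoly_succ n⟩

theorem splitPoly_le_convPoly (n : ℕ) : splitPoly n ≼ convPoly (n + 1) := by
  rw [convPoly, Finset.Nat.sum_antidiagonal_succ']
  refine CoeffLE.trans (CoeffLE.sum fun x _ => ?_) (CoeffLE.add_left _ _)
  rw [mul_assoc, mul_comm (distinctPoly x.2)]
  exact (X_pow_mul_distinctPoly_le _ _ le_rfl).mul_left _

theorem X_mul_splitPoly_le (n : ℕ) : X * splitPoly n ≼ splitPoly (n + 1) := by
  rw [splitPoly, splitPoly, Finset.Nat.sum_antidiagonal_succ, mul_sum]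
  refine CoeffLE.trans (CoeffLE.sum fun x _ => ?_) (CoeffLE.add_left _ _)
  have h := X_pow_mul_distinctPoly_le (x.1 + 1) 1 (by omega)
  convert (h.mul (CoeffLE.refl (distinctPoly x.2 * X ^ x.2))) using 1 <;> ring

theorem X_pow_mul_splitPoly_le (n i : ℕ) (hi : i ≤ n + 2) :
    X ^ i * splitPoly n ≼ splitPoly (n + 2) := by
  rcases i with _ | i
  · simpa using (splitPoly_le_succ n).trans (splitPoly_le_succ (n + 1))
  rw [splitPoly, splitPoly, Finset.Nat.sum_antidiagonal_succ, Finset.Nat.sum_antidiagonal_succ',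
    mul_sum]
  refine CoeffLE.trans (CoeffLE.sum fun x hx => ?_)
    ((CoeffLE.add_left _ _).trans (CoeffLE.add_left _ _))
  have hx := mem_antidiagonal.1 hx
  obtain ⟨a, b, rfl, ha, hb⟩ : ∃ a b, i = a + b ∧ a ≤ x.1 + 1 ∧ b ≤ x.2 :=
    ⟨min i (x.1 + 1), i - min i (x.1 + 1), by omega, by omega, by omega⟩
  have h := (X_pow_mul_distinctPoly_le (x.1 + 1) a ha).mul (X_pow_mul_distinctPoly_le x.2 b hb)
  convert h.mul (CoeffLE.refl (X ^ (x.2 + 1))) using 1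
  ring

/-- The inversion polynomial of `Av(1324, 231)` in length `n`. -/
noncomputable def avPoly : ℕ → ℕ[X]
  | 0 => 1
  | 1 => 1
  | n + 2 => X ^ (n + 1) * avPoly (n + 1) + splitPoly n

theorem X_mul_avPoly_le (n : ℕ) (hmono : ∀ m < n + 1, avPoly m ≼ avPoly (m + 1)) :
    X * avPoly (n + 1) ≼ avPoly (n + 2) := by
  rcases n with _ | n
  · exact ⟨splitPoly 0, by simp [avPoly]⟩
  · rw [avPoly, avPoly]
    convert ((hmono (n + 1) (by omega)).mul_left (X ^ (n + 2))).add (X_mul_splitPoly_le n) using 1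
    ring

theorem X_pow_mul_avPoly_le (i : ℕ) : ∀ n, i ≤ n →
    (∀ m < n + 2, avPoly m ≼ avPoly (m + 1)) → X ^ i * avPoly n ≼ avPoly (n + 2) := by
  induction i using Nat.twoStepInduction with
  | zero =>
    intro n _ hmono
    simpa using (hmono n (by omega)).trans (hmono (n + 1) (by omega))
  | one =>
    intro n hn hmono
    obtain ⟨n, rfl⟩ : ∃ m, n = m + 1 := ⟨n - 1, by omega⟩
    simpa using (X_mul_avPoly_le n fun m hm => hmono m (by omega)).trans (hmono (n + 2) (by omega))
  | more i ih _ =>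
    intro n hn hmono
    obtain ⟨n, rfl⟩ : ∃ m, n = m + 2 := ⟨n - 2, by omega⟩
    have h := (ih (n + 1) (by omega) fun m hm => hmono m (by omega)).mul_left (X ^ (n + 3))
    rw [avPoly, avPoly]
    convert h.add (X_pow_mul_splitPoly_le n (i + 2) (by omega)) using 1
    ring

theorem avPoly_le_succ (n : ℕ) : avPoly n ≼ avPoly (n + 1) := by
  induction n using Nat.strong_induction_on with
  | _ n ih =>
    rcases n with _ | _ | n
    · simpa [avPoly] using CoeffLE.refl 1
    · exact ⟨X, by simp [avPoly, splitPoly, distinctPoly, add_comm]⟩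
    have key : avPoly (n + 1) ≼ X * avPoly (n + 2) + (distinctPoly (n + 1) + convPoly n) := by
      rcases n with _ | n
      · exact ⟨X * avPoly 2 + convPoly 0, by simp only [avPoly, distinctPoly]; ring⟩
      · have h := (X_pow_mul_avPoly_le n (n + 1) (by omega)
          fun m hm => ih m (by omega)).mul_left X
        have h' := h.add ((splitPoly_le_convPoly n).trans
          (CoeffLE.add_left _ (distinctPoly (n + 2))))
        convert h' using 1
        rw [avPoly]
        ring
    rw [avPoly, avPoly, splitPoly_succ]
    convert (key.mul_left (X ^ (n + 1))).add (CoeffLE.refl (splitPoly n)) using 1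
    ring

/-- The number of inversions of a list. -/
def listInv : List ℕ → ℕ
  | [] => 0
  | a :: l => l.countP (· < a) + listInv l

theorem listInv_append (l₁ l₂ : List ℕ) (h : ∀ a ∈ l₁, ∀ b ∈ l₂, a ≤ b) :
    listInv (l₁ ++ l₂) = listInv l₁ + listInv l₂ := by
  induction l₁ with
  | nil => simp [listInv]
  | cons a l ih =>
    have h0 : l₂.countP (· < a) = 0 := by
      rw [List.countP_eq_zero]
      intro b hb
      simpa using h a (by simp) b hb
    rw [List.cons_append, listInv, listInv, List.countP_append, h0,
      ih fun x hx => h x (List.mem_cons_of_mem _ hx)]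
    omega

theorem listInv_cons_of_lt (a : ℕ) (l : List ℕ) (h : ∀ b ∈ l, b < a) :
    listInv (a :: l) = l.length + listInv l := by
  have : l.countP (· < a) = l.length := List.countP_eq_length.2 fun b hb => by simpa using h b hb
  rw [listInv, this]

theorem listInv_cons_of_le (a : ℕ) (l : List ℕ) (h : ∀ b ∈ l, a ≤ b) :
    listInv (a :: l) = listInv l := by
  have : l.countP (· < a) = 0 := List.countP_eq_zero.2 fun b hb => by simpa using h b hb
  rw [listInv, this, zero_add]

/-- No subsequence of length three has its maximum in the middle. -/
def NoPeak (l : List ℕ) : Prop :=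
  ∀ a b c, [a, b, c].Sublist l → ¬ (a < b ∧ c < b)

/-- The list avoids 213 and 231. -/
def HeadExtreme (l : List ℕ) : Prop :=
  ∀ a b c, [a, b, c].Sublist l → ¬ (b < a ∧ a < c) ∧ ¬ (c < a ∧ a < b)

/-- The list avoids 231. -/
def ListAvoids231 (l : List ℕ) : Prop :=
  ∀ a b c, [a, b, c].Sublist l → ¬ (c < a ∧ a < b)

/-- The list avoids 1324. -/
def ListAvoids1324 (l : List ℕ) : Prop :=
  ∀ a b c d, [a, b, c, d].Sublist l → ¬ (a < c ∧ c < b ∧ b < d)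

/-- The list avoids 1324 and 231. -/
def ListAvoids (l : List ℕ) : Prop := ListAvoids1324 l ∧ ListAvoids231 l

theorem pair_sublist_or {l : List ℕ} {x y : ℕ} (hx : x ∈ l) (hy : y ∈ l) (hne : x ≠ y) :
    [x, y].Sublist l ∨ [y, x].Sublist l := by
  induction l with
  | nil => simp at hx
  | cons a l ih =>
    rcases List.mem_cons.1 hx with rfl | hx
    · rcases List.mem_cons.1 hy with rfl | hy
      · exact absurd rfl hne
      · exact Or.inl ((List.singleton_sublist.2 hy).cons_cons _)
    · rcases List.mem_cons.1 hy with rfl | hy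
      · exact Or.inr (List.Sublist.cons_cons y (List.singleton_sublist.2 ‹_›))
      · exact (ih hx hy).imp (·.cons _) (·.cons _)

theorem triple_sublist_append {l₁ l₂ : List ℕ} {a b c : ℕ} (h : [a, b, c].Sublist (l₁ ++ l₂)) :
    [a, b, c].Sublist l₁ ∨ ([a, b].Sublist l₁ ∧ c ∈ l₂) ∨ (a ∈ l₁ ∧ [b, c].Sublist l₂) ∨
      [a, b, c].Sublist l₂ := by
  obtain ⟨u, v, huv, hu, hv⟩ := List.sublist_append_iff.1 h
  rcases u with _ | ⟨_, _ | ⟨_, _ | ⟨_, _ | _⟩⟩⟩ <;> simp at huv <;> grind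

theorem quadruple_sublist_append {l₁ l₂ : List ℕ} {a b c d : ℕ}
    (h : [a, b, c, d].Sublist (l₁ ++ l₂)) :
    [a, b, c, d].Sublist l₁ ∨ ([a, b, c].Sublist l₁ ∧ d ∈ l₂) ∨
      ([a, b].Sublist l₁ ∧ [c, d].Sublist l₂) ∨ (a ∈ l₁ ∧ [b, c, d].Sublist l₂) ∨
      [a, b, c, d].Sublist l₂ := by
  obtain ⟨u, v, huv, hu, hv⟩ := List.sublist_append_iff.1 h
  rcases u with _ | ⟨_, _ | ⟨_, _ | ⟨_, _ | ⟨_, _ | _⟩⟩⟩⟩ <;> simp at huv <;> grind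

theorem mem_of_pair_sublist {l : List ℕ} {a b : ℕ} (h : [a, b].Sublist l) : a ∈ l ∧ b ∈ l :=
  ⟨h.subset (by simp), h.subset (by simp)⟩

theorem mem_of_triple_sublist {l : List ℕ} {a b c : ℕ} (h : [a, b, c].Sublist l) :
    a ∈ l ∧ b ∈ l ∧ c ∈ l :=
  ⟨h.subset (by simp), h.subset (by simp), h.subset (by simp)⟩

theorem noPeak_concat {l : List ℕ} {m : ℕ} (h : NoPeak l) (hm : ∀ x ∈ l, x < m) :
    NoPeak (l ++ [m]) := by
  rintro a b c habc ⟨h1, h2⟩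
  rcases triple_sublist_append habc with h' | ⟨h', hc⟩ | ⟨_, h'⟩ | h'
  · exact h a b c h' ⟨h1, h2⟩
  · have := hm b (mem_of_pair_sublist h').2
    simp at hc
    omega
  · simpa using h'.length_le
  · simpa using h'.length_le

theorem noPeak_cons {l : List ℕ} {m : ℕ} (h : NoPeak l) (hm : ∀ x ∈ l, x < m) :
    NoPeak (m :: l) := by
  rintro a b c habc ⟨h1, h2⟩
  rcases List.sublist_cons_iff.1 habc with h' | ⟨r, hr, h'⟩
  · exact h a b c h' ⟨h1, h2⟩
  · simp only [List.cons.injEq] at hr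
    obtain ⟨rfl, rfl⟩ := hr
    have := hm b (mem_of_pair_sublist h').1
    omega

theorem headExtreme_cons {l : List ℕ} {m : ℕ} (h : HeadExtreme l)
    (hm : (∀ x ∈ l, x < m) ∨ ∀ x ∈ l, m < x) : HeadExtreme (m :: l) := by
  intro a b c habc
  rcases List.sublist_cons_iff.1 habc with h' | ⟨r, hr, h'⟩
  · exact h a b c h'
  · simp only [List.cons.injEq] at hr
    obtain ⟨rfl, rfl⟩ := hr
    obtain ⟨hb, hc⟩ := mem_of_pair_sublist h'
    rcases hm with hm | hm
    · have := hm b hb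
      have := hm c hc
      omega
    · have := hm b hb
      have := hm c hc
      omega

theorem listAvoids_cons {l : List ℕ} {m : ℕ} (h : ListAvoids l) (hm : ∀ x ∈ l, x < m) :
    ListAvoids (m :: l) := by
  constructor
  · rintro a b c d habcd ⟨h1, h2, h3⟩
    rcases List.sublist_cons_iff.1 habcd with h' | ⟨r, hr, h'⟩
    · exact h.1 a b c d h' ⟨h1, h2, h3⟩
    · simp only [List.cons.injEq] at hr
      obtain ⟨rfl, rfl⟩ := hr
      have := hm c (mem_of_triple_sublist h').2.1
      omega
  · rintro a b c habc ⟨h1, h2⟩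
    rcases List.sublist_cons_iff.1 habc with h' | ⟨r, hr, h'⟩
    · exact h.2 a b c h' ⟨h1, h2⟩
    · simp only [List.cons.injEq] at hr
      obtain ⟨rfl, rfl⟩ := hr
      have := hm b (mem_of_pair_sublist h').1
      omega

theorem listAvoids_append_cons {l₁ l₂ : List ℕ} {m : ℕ} (h₁ : NoPeak l₁) (h₂ : HeadExtreme l₂)
    (hm₁ : ∀ x ∈ l₁, x < m) (hm₂ : ∀ x ∈ l₂, x < m) (hlt : ∀ x ∈ l₁, ∀ y ∈ l₂, x < y) :
    ListAvoids (l₁ ++ m :: l₂) := by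
  have hE : HeadExtreme (m :: l₂) := headExtreme_cons h₂ (Or.inl hm₂)
  have hlt' : ∀ x ∈ l₁, ∀ y ∈ m :: l₂, x < y := by
    intro x hx y hy
    rcases List.mem_cons.1 hy with rfl | hy
    · exact hm₁ x hx
    · exact hlt x hx y hy
  constructor
  · rintro a b c d habcd ⟨h1, h2, h3⟩
    rcases quadruple_sublist_append habcd with h' | ⟨h', hd⟩ | ⟨h', h''⟩ | ⟨_, h'⟩ | h'
    · exact h₁ a b c ((List.sublist_append_left [a, b, c] [d]).trans h') ⟨by omega, h2⟩
    · exact h₁ a b c h' ⟨by omega, h2⟩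
    · have := hlt' b (mem_of_pair_sublist h').2 c (mem_of_pair_sublist h'').1
      omega
    · exact (hE b c d h').1 ⟨h2, h3⟩
    · exact (hE b c d (List.Sublist.trans (List.sublist_cons_self a _) h')).1 ⟨h2, h3⟩
  · rintro a b c habc ⟨h1, h2⟩
    rcases triple_sublist_append habc with h' | ⟨h', hc⟩ | ⟨ha, h'⟩ | h'
    · exact h₁ a b c h' ⟨h2, by omega⟩
    · have := hlt' a (mem_of_pair_sublist h').1 c hc
      omega
    · have := hlt' a ha c (mem_of_pair_sublist h').2
      omega
    · exact (hE a b c h').2 ⟨h1, h2⟩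

theorem NoPeak.sublist {l l' : List ℕ} (h : NoPeak l) (hl : l'.Sublist l) : NoPeak l' :=
  fun a b c habc => h a b c (habc.trans hl)

theorem HeadExtreme.sublist {l l' : List ℕ} (h : HeadExtreme l) (hl : l'.Sublist l) :
    HeadExtreme l' :=
  fun a b c habc => h a b c (habc.trans hl)

theorem ListAvoids.sublist {l l' : List ℕ} (h : ListAvoids l) (hl : l'.Sublist l) :
    ListAvoids l' :=
  ⟨fun a b c d habcd => h.1 a b c d (habcd.trans hl), fun a b c habc => h.2 a b c (habc.trans hl)⟩

/-- The rearrangements of `l` that satisfy `P`. -/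
noncomputable def arrangements (l : List ℕ) (P : List ℕ → Prop) : Finset (List ℕ) :=
  open Classical in l.permutations.toFinset.filter P

theorem mem_arrangements {l l' : List ℕ} {P : List ℕ → Prop} :
    l' ∈ arrangements l P ↔ l'.Perm l ∧ P l' := by
  simp [arrangements, List.mem_permutations]

/-- The inversion polynomial of a set of lists. -/
noncomputable def invPoly (s : Finset (List ℕ)) : ℕ[X] := ∑ l ∈ s, X ^ listInv l

theorem coeff_invPoly (s : Finset (List ℕ)) (k : ℕ) :
    (invPoly s).coeff k = #{l ∈ s | listInv l = k} := by
  simp [invPoly, Polynomial.finsetSum_coeff, coeff_X_pow, eq_comm]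

theorem invPoly_image {s : Finset (List ℕ)} {f : List ℕ → List ℕ} (hf : Function.Injective f)
    (d : ℕ) (hd : ∀ l ∈ s, listInv (f l) = d + listInv l) :
    invPoly (s.image f) = X ^ d * invPoly s := by
  rw [invPoly, sum_image hf.injOn, invPoly, mul_sum]
  exact sum_congr rfl fun l hl => by rw [hd l hl, pow_add]

theorem invPoly_union {s t : Finset (List ℕ)} (h : Disjoint s t) :
    invPoly (s ∪ t) = invPoly s + invPoly t :=
  sum_union h

theorem invPoly_arrangements_nil {P : List ℕ → Prop} (h : P []) :
    invPoly (arrangements [] P) = 1 := by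
  have : arrangements [] P = {[]} := by
    ext l
    rw [mem_arrangements, List.perm_nil, mem_singleton]
    exact ⟨And.left, fun hl => ⟨hl, hl ▸ h⟩⟩
  simp [this, invPoly, listInv]

theorem invPoly_arrangements_singleton {P : List ℕ → Prop} (a : ℕ) (h : P [a]) :
    invPoly (arrangements [a] P) = 1 := by
  have : arrangements [a] P = {[a]} := by
    ext l
    rw [mem_arrangements, List.perm_singleton, mem_singleton]
    exact ⟨And.left, fun hl => ⟨hl, hl ▸ h⟩⟩
  simp [this, invPoly, listInv]

theorem arrangements_range_noPeak (m : ℕ) :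
    arrangements (List.range (m + 1)) NoPeak =
      (arrangements (List.range m) NoPeak).image (· ++ [m]) ∪
        (arrangements (List.range m) NoPeak).image (m :: ·) := by
  ext l
  simp only [mem_union, mem_image, mem_arrangements]
  constructor
  · rintro ⟨hp, hl⟩
    obtain ⟨u, v, rfl⟩ := List.append_of_mem (hp.mem_iff.2 (by simp : m ∈ List.range (m + 1)))
    rw [List.range_succ] at hp
    have hp' : (u ++ v).Perm (List.range m) :=
      (List.perm_cons m).1 (List.perm_middle.symm.trans
        (hp.trans (List.perm_append_singleton m _)))
    have hlt : ∀ x ∈ u ++ v, x < m := fun x hx => List.mem_range.1 (hp'.mem_iff.1 hx)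
    rcases u with _ | ⟨a, u⟩
    · exact Or.inr ⟨v, ⟨hp', hl.sublist (List.sublist_cons_self _ _)⟩, rfl⟩
    rcases v with _ | ⟨b, v⟩
    · exact Or.inl ⟨a :: u, ⟨by simpa using hp', hl.sublist (List.sublist_append_left _ _)⟩, rfl⟩
    refine absurd ⟨hlt a (by simp), hlt b (by simp)⟩ (hl a m b ?_)
    exact List.Sublist.append (l₁ := [a]) (by simp) (by simp)
  · rintro (⟨u, ⟨hp, hu⟩, rfl⟩ | ⟨u, ⟨hp, hu⟩, rfl⟩)
    · refine ⟨?_, noPeak_concat hu fun x hx => List.mem_range.1 (hp.mem_iff.1 hx)⟩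
      rw [List.range_succ]
      exact hp.append_right _
    · refine ⟨?_, noPeak_cons hu fun x hx => List.mem_range.1 (hp.mem_iff.1 hx)⟩
      rw [List.range_succ]
      exact (hp.cons m).trans (List.perm_append_singleton m _).symm

theorem invPoly_noPeak (m : ℕ) :
    invPoly (arrangements (List.range m) NoPeak) = distinctPoly m := by
  induction m with
  | zero => exact invPoly_arrangements_nil fun a b c h => by simp at h
  | succ m ih =>
    rcases m with _ | m
    · exact invPoly_arrangements_singleton 0 fun a b c h => by simpa using h.length_le
    have hlt : ∀ l ∈ arrangements (List.range (m + 1)) NoPeak, ∀ x ∈ l, x < m + 1 :=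
      fun l hl x hx => List.mem_range.1 ((mem_arrangements.1 hl).1.mem_iff.1 hx)
    have hlen : ∀ l ∈ arrangements (List.range (m + 1)) NoPeak, l.length = m + 1 :=
      fun l hl => by simpa using (mem_arrangements.1 hl).1.length_eq
    rw [arrangements_range_noPeak, invPoly_union,
      invPoly_image (List.append_left_injective _) 0, invPoly_image (List.cons_injective) (m + 1),
      ih, distinctPoly]
    · ring
    · intro l hl
      rw [listInv_cons_of_lt _ _ (hlt l hl), hlen l hl]
    · intro l hl
      rw [listInv_append _ _ fun a ha b hb => ?_]
      · simp [listInv]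
      · have := hlt l hl a ha
        simp at hb
        omega
    · rw [disjoint_left]
      intro l h₁ h₂
      obtain ⟨u, hu, rfl⟩ := mem_image.1 h₁
      obtain ⟨v, hv, huv⟩ := mem_image.1 h₂
      rcases u with _ | ⟨a, u⟩
      · simpa using hlen _ hu
      · have := hlt _ hu a (by simp)
        simp at huv
        omega

theorem arrangements_range'_headExtreme (s r : ℕ) :
    arrangements (List.range' s (r + 2)) HeadExtreme =
      (arrangements (List.range' (s + 1) (r + 1)) HeadExtreme).image (s :: ·) ∪
        (arrangements (List.range' s (r + 1)) HeadExtreme).image ((s + r + 1) :: ·) := by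
  have hlast : (List.range' s (r + 2)).Perm ((s + r + 1) :: List.range' s (r + 1)) := by
    rw [List.range'_1_concat (n := r + 1)]
    exact List.perm_append_singleton _ _
  ext l
  simp only [mem_union, mem_image, mem_arrangements]
  constructor
  · rintro ⟨hp, hl⟩
    rcases l with _ | ⟨a, l⟩
    · simpa using hp.length_eq
    have hl' : HeadExtreme l := hl.sublist (List.sublist_cons_self _ _)
    by_cases h1 : a = s
    · subst h1
      exact Or.inl ⟨l, ⟨(List.perm_cons a).1 hp, hl'⟩, rfl⟩
    by_cases h2 : a = s + r + 1
    · subst h2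
      exact Or.inr ⟨l, ⟨(List.perm_cons _).1 (hp.trans hlast), hl'⟩, rfl⟩
    have ha : s ≤ a ∧ a < s + (r + 2) := by simpa using hp.mem_iff.1 (by simp : a ∈ a :: l)
    have hmin : s ∈ l := by
      have : s ∈ a :: l := hp.mem_iff.2 (by simp)
      simpa [Ne.symm h1] using this
    have hmax : s + r + 1 ∈ l := by
      have : s + r + 1 ∈ a :: l := hp.mem_iff.2 (by simp; omega)
      simpa [Ne.symm h2] using this
    rcases pair_sublist_or hmin hmax (by omega) with h | h
    · exact absurd (by omega) (hl _ _ _ (h.cons_cons a)).1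
    · exact absurd (by omega) (hl _ _ _ (h.cons_cons a)).2
  · rintro (⟨u, ⟨hp, hu⟩, rfl⟩ | ⟨u, ⟨hp, hu⟩, rfl⟩)
    · refine ⟨hp.cons s, headExtreme_cons hu (Or.inr fun x hx => ?_)⟩
      have := hp.mem_iff.1 hx
      simp at this
      omega
    · refine ⟨(hp.cons _).trans hlast.symm, headExtreme_cons hu (Or.inl fun x hx => ?_)⟩
      have := hp.mem_iff.1 hx
      simp at this
      omega

theorem invPoly_headExtreme (r : ℕ) :
    ∀ s, invPoly (arrangements (List.range' s r) HeadExtreme) = distinctPoly r := by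
  induction r with
  | zero => exact fun s => invPoly_arrangements_nil fun a b c h => by simp at h
  | succ r ih =>
    intro s
    rcases r with _ | r
    · exact invPoly_arrangements_singleton s fun a b c h => by simpa using h.length_le
    rw [arrangements_range'_headExtreme, invPoly_union,
      invPoly_image (List.cons_injective) 0, invPoly_image (List.cons_injective) (r + 1),
      ih, ih, distinctPoly]
    · ring
    · intro l hl
      have hp := (mem_arrangements.1 hl).1
      rw [listInv_cons_of_lt, hp.length_eq, List.length_range']
      intro b hb
      have := hp.mem_iff.1 hb
      simp at this
      omega
    · intro l hl
      have hp := (mem_arrangements.1 hl).1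
      rw [listInv_cons_of_le, zero_add]
      intro b hb
      have := hp.mem_iff.1 hb
      simp at this
      omega
    · rw [disjoint_left]
      intro l h₁ h₂
      obtain ⟨u, hu, rfl⟩ := mem_image.1 h₁
      obtain ⟨v, hv, huv⟩ := mem_image.1 h₂
      simp at huv
      omega

theorem perm_range_of_append {l₁ l₂ : List ℕ} {n : ℕ} (hp : (l₁ ++ l₂).Perm (List.range n))
    (hlt : ∀ x ∈ l₁, ∀ y ∈ l₂, x < y) :
    l₁.Perm (List.range l₁.length) ∧ l₂.Perm (List.range' l₁.length l₂.length) := by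
  have hlen : l₁.length + l₂.length = n := by simpa using hp.length_eq
  have hp₁ := l₁.mergeSort_perm (· ≤ ·)
  have hp₂ := l₂.mergeSort_perm (· ≤ ·)
  have hsort : (l₁.mergeSort (· ≤ ·) ++ l₂.mergeSort (· ≤ ·)) = List.range n := by
    refine ((hp₁.append hp₂).trans hp).eq_of_pairwise' (r := (· ≤ ·)) ?_ ?_
    · refine List.pairwise_append.2 ⟨List.pairwise_mergeSort' _ _, List.pairwise_mergeSort' _ _,
        fun a ha b hb => (hlt a (hp₁.mem_iff.1 ha) b (hp₂.mem_iff.1 hb)).le⟩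
    · exact List.pairwise_lt_range.imp le_of_lt
  have hrange : List.range n = List.range l₁.length ++ List.range' l₁.length l₂.length := by
    rw [← hlen, List.range_eq_range', List.range_eq_range', ← List.range'_append_1]
    simp
  rw [hrange] at hsort
  obtain ⟨h1, h2⟩ := List.append_inj hsort (by simp)
  exact ⟨h1 ▸ hp₁.symm, h2 ▸ hp₂.symm⟩

/-- The lists `u ++ n :: v` with `u` a rearrangement of `0, …, a - 1` without peaks and `v` a
rearrangement of `a, …, a + b - 1` avoiding 213 and 231. -/
noncomputable def splitArrangements (n a b : ℕ) : Finset (List ℕ) :=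
  (arrangements (List.range a) NoPeak ×ˢ arrangements (List.range' a b) HeadExtreme).image
    fun x => x.1 ++ n :: x.2

theorem arrangements_range_listAvoids (n : ℕ) :
    arrangements (List.range (n + 2)) ListAvoids =
      (arrangements (List.range (n + 1)) ListAvoids).image ((n + 1) :: ·) ∪
        (antidiagonal n).biUnion fun x => splitArrangements (n + 1) (x.1 + 1) x.2 := by
  ext l
  simp only [mem_union, mem_image, mem_arrangements, mem_biUnion, HasAntidiagonal.mem_antidiagonal,
    splitArrangements, mem_product, Prod.exists]
  rw [List.range_succ (n := n + 1)]
  constructor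
  · rintro ⟨hp, hl⟩
    obtain ⟨u, v, rfl⟩ := List.append_of_mem (hp.mem_iff.2 (by simp : n + 1 ∈ _))
    have hp' : (u ++ v).Perm (List.range (n + 1)) :=
      (List.perm_cons (n + 1)).1 (List.perm_middle.symm.trans
        (hp.trans (List.perm_append_singleton _ _)))
    have hlt : ∀ x ∈ u ++ v, x < n + 1 := fun x hx => List.mem_range.1 (hp'.mem_iff.1 hx)
    have hnd : (u ++ v).Nodup := hp'.nodup_iff.2 List.nodup_range
    rcases u.eq_nil_or_concat with rfl | ⟨_, _, hu⟩
    · exact Or.inl ⟨v, ⟨hp', hl.sublist (List.sublist_cons_self _ _)⟩, rfl⟩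
    have hpos : 0 < u.length := by simp [hu]
    have huv : ∀ x ∈ u, ∀ y ∈ v, x < y := by
      intro x hx y hy
      have hne : x ≠ y := (List.nodup_append.1 hnd).2.2 x hx y hy
      have hsub : [x, n + 1, y].Sublist (u ++ (n + 1) :: v) :=
        List.Sublist.append (l₁ := [x]) (by simpa using hx)
          (List.Sublist.cons_cons _ (by simpa using hy))
      have := hl.2 _ _ _ hsub
      have := hlt x (by simp [hx])
      omega
    obtain ⟨h1, h2⟩ := perm_range_of_append hp' huv
    have hlen : u.length + v.length = n + 1 := by simpa using hp'.length_eq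
    refine Or.inr ⟨u.length - 1, v.length, by omega, u, v, ⟨⟨?_, ?_⟩, ?_, ?_⟩, rfl⟩
    · rwa [Nat.sub_add_cancel hpos]
    · intro a b c habc hpeak
      have hne : a ≠ c := by
        have := ((List.nodup_append.1 hnd).1.sublist habc)
        simp at this
        tauto
      have hb := hlt b (by simp [(mem_of_triple_sublist habc).2.1])
      have h1324 := hl.1 a b c (n + 1) (List.Sublist.append (l₁ := [a, b, c]) habc (by simp))
      have h231 := hl.2 a b c (habc.trans (List.sublist_append_left _ _))
      omega
    · rwa [Nat.sub_add_cancel hpos]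
    · intro a b c habc
      have hsub : [a, b, c].Sublist ((n + 1) :: v) := habc.cons _
      refine ⟨fun h213 => ?_, hl.2 a b c (hsub.trans (List.sublist_append_right _ _))⟩
      obtain ⟨x, hx⟩ := List.exists_mem_of_length_pos hpos
      have hxb := huv x hx b (mem_of_triple_sublist habc).2.1
      exact hl.1 x a b c (List.Sublist.append (l₁ := [x]) (by simpa using hx) hsub)
        ⟨hxb, h213⟩
  · rintro (⟨u, ⟨hp, hu⟩, rfl⟩ | ⟨a, b, hab, u, v, ⟨⟨hpu, hu⟩, hpv, hv⟩, rfl⟩)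
    · exact ⟨(hp.cons _).trans (List.perm_append_singleton _ _).symm,
        listAvoids_cons hu fun x hx => List.mem_range.1 (hp.mem_iff.1 hx)⟩
    · have hmu : ∀ x ∈ u, x < a + 1 := fun x hx => List.mem_range.1 (hpu.mem_iff.1 hx)
      have hmv : ∀ x ∈ v, a + 1 ≤ x ∧ x < a + 1 + b :=
        fun x hx => by simpa using hpv.mem_iff.1 hx
      refine ⟨?_, listAvoids_append_cons hu hv ?_ ?_ ?_⟩
      · have hrange : List.range (n + 1) = List.range (a + 1) ++ List.range' (a + 1) b := by
          rw [← hab, List.range_eq_range', List.range_eq_range', add_right_comm,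
            ← List.range'_append_1]
          simp
        rw [hrange]
        exact (List.perm_middle.trans ((hpu.append hpv).cons _)).trans
          (List.perm_append_singleton _ _).symm
      · intro x hx
        have := hmu x hx
        omega
      · intro x hx
        have := hmv x hx
        omega
      · intro x hx y hy
        have := hmu x hx
        have := hmv y hy
        omega

theorem mem_splitArrangements {n a b : ℕ} {l : List ℕ} :
    l ∈ splitArrangements n a b ↔ ∃ u v, (u.Perm (List.range a) ∧ NoPeak u) ∧
      (v.Perm (List.range' a b) ∧ HeadExtreme v) ∧ u ++ n :: v = l := by
  simp [splitArrangements, mem_arrangements, and_assoc]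

theorem invPoly_splitArrangements {n a b : ℕ} (h : a + b = n) :
    invPoly (splitArrangements n a b) = distinctPoly a * distinctPoly b * X ^ b := by
  have hinj : Set.InjOn (fun x : List ℕ × List ℕ => x.1 ++ n :: x.2)
      (arrangements (List.range a) NoPeak ×ˢ arrangements (List.range' a b) HeadExtreme :
        Finset (List ℕ × List ℕ)) := by
    rintro ⟨u, v⟩ huv ⟨u', v'⟩ huv' heq
    simp only [coe_product, Set.mem_prod, mem_coe, mem_arrangements] at huv huv'
    have := List.append_inj heq (huv.1.1.length_eq.trans huv'.1.1.length_eq.symm)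
    simp_all
  rw [invPoly, splitArrangements, sum_image hinj, ← invPoly_noPeak a, ← invPoly_headExtreme b a,
    invPoly, invPoly, sum_mul_sum, ← sum_product', sum_mul]
  refine sum_congr rfl fun x hx => ?_
  obtain ⟨⟨hu, -⟩, hv, -⟩ := by simpa only [mem_product, mem_arrangements] using hx
  have hmu : ∀ y ∈ x.1, y < a := fun y hy => List.mem_range.1 (hu.mem_iff.1 hy)
  have hmv : ∀ y ∈ x.2, a ≤ y ∧ y < a + b := fun y hy => by simpa using hv.mem_iff.1 hy
  have hlen : x.2.length = b := by simpa using hv.length_eq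
  rw [listInv_append, listInv_cons_of_lt, hlen]
  · ring
  · exact fun y hy => h ▸ (hmv y hy).2
  · intro y hy z hz
    have := hmu y hy
    rcases List.mem_cons.1 hz with rfl | hz
    · omega
    · have := hmv z hz
      omega

theorem invPoly_listAvoids (n : ℕ) :
    invPoly (arrangements (List.range n) ListAvoids) = avPoly n := by
  induction n with
  | zero =>
    exact invPoly_arrangements_nil ⟨fun a b c d h => by simp at h, fun a b c h => by simp at h⟩
  | succ n ih =>
    rcases n with _ | n
    · exact invPoly_arrangements_singleton 0
        ⟨fun a b c d h => by simpa using h.length_le, fun a b c h => by simpa using h.length_le⟩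
    have hlt : ∀ {a b : ℕ} {u : List ℕ}, a + b = n → u.Perm (List.range (a + 1)) →
        n + 1 ∉ u := by
      intro a b u hab hu hn
      have := List.mem_range.1 (hu.mem_iff.1 hn)
      omega
    rw [arrangements_range_listAvoids, invPoly_union,
      invPoly_image List.cons_injective (n + 1), ih, avPoly, splitPoly]
    · congr 1
      rw [invPoly, sum_biUnion]
      · refine sum_congr rfl fun x hx => ?_
        have := HasAntidiagonal.mem_antidiagonal.1 hx
        exact invPoly_splitArrangements (by omega)
      · intro x hx y hy hxy
        have hx := HasAntidiagonal.mem_antidiagonal.1 hx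
        have hy := HasAntidiagonal.mem_antidiagonal.1 hy
        rw [Function.onFun, disjoint_left]
        intro l h₁ h₂
        obtain ⟨u, v, ⟨hu, -⟩, -, rfl⟩ := mem_splitArrangements.1 h₁
        obtain ⟨u', v', ⟨hu', -⟩, -, heq⟩ := mem_splitArrangements.1 h₂
        have hfst := congrArg (List.idxOf (n + 1)) heq
        rw [List.idxOf_append_of_notMem (hlt hy hu'), List.idxOf_append_of_notMem (hlt hx hu)]
          at hfst
        have h1 : x.1 = y.1 := by simpa [hu.length_eq, hu'.length_eq] using hfst.symm
        exact hxy (Prod.ext h1 (by omega))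
    · intro l hl
      have hp := (mem_arrangements.1 hl).1
      rw [listInv_cons_of_lt, hp.length_eq, List.length_range]
      exact fun x hx => List.mem_range.1 (hp.mem_iff.1 hx)
    · rw [disjoint_left]
      intro l h₁ h₂
      obtain ⟨w, hw, rfl⟩ := mem_image.1 h₁
      obtain ⟨x, hx, hx'⟩ := mem_biUnion.1 h₂
      obtain ⟨u, v, ⟨hu, -⟩, -, heq⟩ := mem_splitArrangements.1 hx'
      have hn := hlt (HasAntidiagonal.mem_antidiagonal.1 hx) hu
      rcases u with _ | ⟨a, u⟩
      · simpa using hu.length_eq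
      · simp at heq
        simp [heq.1] at hn

/-- The one-line notation of a permutation. -/
def oneLine {n : ℕ} (π : Equiv.Perm (Fin n)) : List ℕ := List.ofFn fun i => (π i : ℕ)

theorem oneLine_injective {n : ℕ} : Function.Injective (oneLine (n := n)) := by
  intro π σ h
  ext i
  exact congrFun (List.ofFn_injective h) i

theorem oneLine_perm {n : ℕ} (π : Equiv.Perm (Fin n)) : (oneLine π).Perm (List.range n) := by
  refine (List.perm_ext_iff_of_nodup ?_ List.nodup_range).2 fun x => ?_
  · exact List.nodup_ofFn.2 (Fin.val_injective.comp π.injective)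
  · rw [oneLine, List.mem_ofFn', List.mem_range]
    constructor
    · rintro ⟨i, rfl⟩
      exact (π i).isLt
    · exact fun hx => ⟨π.symm ⟨x, hx⟩, by simp⟩

theorem exists_oneLine_eq {n : ℕ} {l : List ℕ} (hl : l.Perm (List.range n)) :
    ∃ π : Equiv.Perm (Fin n), oneLine π = l := by
  have hlen : l.length = n := by simpa using hl.length_eq
  have hnd : l.Nodup := hl.nodup_iff.2 List.nodup_range
  subst hlen
  let f : Fin l.length → Fin l.length :=
    fun i => ⟨l.get i, List.mem_range.1 (hl.mem_iff.1 (l.get_mem i))⟩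
  have hf : Function.Injective f := fun i j hij =>
    List.nodup_iff_injective_get.1 hnd (congrArg Fin.val hij)
  exact ⟨Equiv.ofBijective f (Finite.injective_iff_bijective.1 hf), List.ofFn_get l⟩

theorem listInv_ofFn {n : ℕ} (f : Fin n → ℕ) :
    listInv (List.ofFn f) = ∑ i, ∑ j, if i < j ∧ f j < f i then 1 else 0 := by
  induction n with
  | zero => simp [listInv]
  | succ n ih =>
    have hcount : (List.ofFn fun i : Fin n => f i.succ).countP (· < f 0) =
        ∑ j : Fin n, if f j.succ < f 0 then 1 else 0 := by
      rw [List.ofFn_eq_map, List.countP_map, ← Finset.card_filter, Finset.card_def,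
        Finset.filter_val, ← Multiset.countP_eq_card_filter]
      exact List.countP_congr fun _ _ => by simp
    rw [List.ofFn_succ, listInv, hcount, ih]
    simp only [Fin.sum_univ_succ, Fin.succ_lt_succ_iff, Fin.succ_pos, Fin.not_lt_zero,
      true_and, false_and, if_false, zero_add]

theorem listInv_oneLine {n : ℕ} (π : Equiv.Perm (Fin n)) : listInv (oneLine π) = invCount π := by
  rw [oneLine, listInv_ofFn, invCount, Nat.card_eq_fintype_card, Fintype.card_subtype,
    Finset.card_filter, ← univ_product_univ, sum_product]
  rfl

theorem map_sublist_oneLine {n : ℕ} (π : Equiv.Perm (Fin n)) {m : ℕ} {f : Fin m → Fin n}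
    (hf : StrictMono f) : (List.ofFn fun i => (π (f i) : ℕ)).Sublist (oneLine π) := by
  refine List.sublist_iff_exists_fin_orderEmbedding_get_eq.2
    ⟨OrderEmbedding.ofStrictMono
      (fun i => Fin.cast (by simp [oneLine]) (f (Fin.cast (by simp) i))) fun i j hij => ?_, ?_⟩
  · exact hf (a := Fin.cast _ i) (b := Fin.cast _ j) hij
  · intro i
    simp only [oneLine, List.get_ofFn]
    rfl

theorem exists_strictMono_of_sublist_oneLine {n : ℕ} {π : Equiv.Perm (Fin n)} {l : List ℕ}
    (hl : l.Sublist (oneLine π)) :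
    ∃ f : Fin l.length → Fin n, StrictMono f ∧ ∀ i, (π (f i) : ℕ) = l.get i := by
  obtain ⟨f, hf⟩ := List.sublist_iff_exists_fin_orderEmbedding_get_eq.1 hl
  refine ⟨fun i => Fin.cast (by simp [oneLine]) (f i), fun i j hij => f.strictMono hij,
    fun i => ?_⟩
  rw [hf i]
  simp [oneLine, Fin.cast]

theorem listAvoids231_oneLine {n : ℕ} (π : Equiv.Perm (Fin n)) :
    ListAvoids231 (oneLine π) ↔ Avoids π p231 := by
  constructor
  · rintro h ⟨f, hf, hp⟩
    refine h _ _ _ (by simpa using map_sublist_oneLine π hf) ⟨?_, ?_⟩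
    · exact (hp 2 0).2 (by decide)
    · exact (hp 0 1).2 (by decide)
  · rintro h a b c habc ⟨h1, h2⟩
    obtain ⟨f, hf, hp⟩ := exists_strictMono_of_sublist_oneLine habc
    refine h ⟨f, hf, fun i j => ?_⟩
    rw [Fin.lt_def, hp, hp]
    fin_cases i <;> fin_cases j <;> simp [p231] <;> omega

theorem listAvoids1324_oneLine {n : ℕ} (π : Equiv.Perm (Fin n)) :
    ListAvoids1324 (oneLine π) ↔ Avoids π p1324 := by
  constructor
  · rintro h ⟨f, hf, hp⟩
    refine h _ _ _ _ (by simpa using map_sublist_oneLine π hf) ⟨?_, ?_, ?_⟩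
    · exact (hp 0 2).2 (by decide)
    · exact (hp 2 1).2 (by decide)
    · exact (hp 1 3).2 (by decide)
  · rintro h a b c d habcd ⟨h1, h2, h3⟩
    obtain ⟨f, hf, hp⟩ := exists_strictMono_of_sublist_oneLine habcd
    refine h ⟨f, hf, fun i j => ?_⟩
    rw [Fin.lt_def, hp, hp]
    fin_cases i <;> fin_cases j <;> simp [p1324] <;> omega

theorem card_avoiders_eq_coeff (n k : ℕ) :
    Nat.card {π : Equiv.Perm (Fin n) // invCount π = k ∧ Avoids π p1324 ∧ Avoids π p231} =
      (avPoly n).coeff k := by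
  classical
  rw [← invPoly_listAvoids, coeff_invPoly, Nat.card_eq_fintype_card, Fintype.card_subtype]
  refine card_bij (fun π _ => oneLine π) ?_ (fun _ _ _ _ h => oneLine_injective h) ?_
  · intro π hπ
    simpa [mem_arrangements, oneLine_perm, listInv_oneLine, ListAvoids, listAvoids1324_oneLine,
      listAvoids231_oneLine, and_comm] using hπ
  · intro l hl
    obtain ⟨hl, hk⟩ := mem_filter.1 hl
    obtain ⟨hp, h1, h2⟩ := mem_arrangements.1 hl
    obtain ⟨π, rfl⟩ := exists_oneLine_eq hp
    exact ⟨π, by simpa using ⟨listInv_oneLine π ▸ hk, (listAvoids1324_oneLine π).1 h1,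
      (listAvoids231_oneLine π).1 h2⟩, rfl⟩

/-- The pair {1324, 231} is inversion monotone: for every `n ≥ 1` and `k ≥ 0`,
`av_n^k({1324, 231}) ≤ av_{n+1}^k({1324, 231})`. -/
theorem inversion_monotone_1324_231 (n k : ℕ) (hn : 1 ≤ n) :
    Nat.card {π : Equiv.Perm (Fin n) // invCount π = k ∧ Avoids π p1324 ∧ Avoids π p231} ≤
    Nat.card {π : Equiv.Perm (Fin (n + 1)) //
      invCount π = k ∧ Avoids π p1324 ∧ Avoids π p231} := by
  rw [card_avoiders_eq_coeff, card_avoiders_eq_coeff]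
  exact (avPoly_le_succ n).coeff_le k
end

section
/- For every k ≥ 0 and every n ≥ k + 2, the number of permutations of length n with exactly k inversions that avoid the pattern 1324 equals Σ_{i=0}^{k} p(i)·p(k−i), where p(j) is the number of integer partitions of j. -/
open Finset Equiv

section LehmerCode

variable {n : ℕ}

/-- The `i`-th entry of the Lehmer code of `π`: the number of smaller entries to the right
of position `i`. -/
def lehmer (π : Perm (Fin n)) (i : Fin n) : ℕ := #{j | i < j ∧ π j < π i}

theorem invCount_eq_card (π : Perm (Fin n)) :
    invCount π = #{ij : Fin n × Fin n | ij.1 < ij.2 ∧ π ij.2 < π ij.1} := by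
  rw [invCount, Nat.card_eq_fintype_card, Fintype.card_subtype]

theorem invCount_eq_sum_lehmer (π : Perm (Fin n)) : invCount π = ∑ i, lehmer π i := by
  simp only [invCount_eq_card, lehmer, card_filter, Fintype.sum_prod_type]

theorem card_apply_lt (π : Perm (Fin n)) (v : Fin n) : #{j | π j < v} = (v : ℕ) := by
  rw [← Fin.card_Iio v]
  refine card_bij (fun j _ => π j) (by simp) (by simp) fun b hb => ⟨π.symm b, by simpa using hb⟩

theorem lehmer_add_le (π : Perm (Fin n)) (i : Fin n) : lehmer π i + i + 1 ≤ n := by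
  have h : lehmer π i ≤ #(Ioi i) := card_le_card fun j => by simp +contextual
  rw [Fin.card_Ioi] at h
  omega

theorem apply_le_lehmer_add (π : Perm (Fin n)) (i : Fin n) : (π i : ℕ) ≤ lehmer π i + i := by
  rw [← card_apply_lt π (π i), ← Fin.card_Iio i]
  refine (card_le_card ?_).trans (card_union_le _ _)
  intro j hj
  have : j ≠ i := by rintro rfl; simp at hj
  simp only [mem_filter, mem_univ, true_and, mem_union, mem_Iio] at hj ⊢
  rcases lt_or_gt_of_ne this with h | h <;> simp [h, hj]

theorem lehmer_eq_card_unused (π : Perm (Fin n)) (i : Fin n) :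
    lehmer π i = #{v | v < π i ∧ ∀ j < i, π j ≠ v} := by
  refine card_bij (fun j _ => π j) ?_ (by simp) ?_
  · simp only [mem_filter, mem_univ, true_and, and_imp]
    refine fun a h1 h2 => ⟨h2, fun j hj h => ?_⟩
    rw [π.injective h] at hj
    exact lt_asymm h1 hj
  · simp only [mem_filter, mem_univ, true_and, and_imp]
    refine fun v h1 h2 => ⟨π.symm v, ⟨?_, by simpa using h1⟩, by simp⟩
    by_contra! h
    rcases h.lt_or_eq with h | h
    · exact h2 _ h (by simp)
    · rw [← h] at h1; simp at h1

theorem not_apply_lt_of_lehmer_eq {π σ : Perm (Fin n)} {i : Fin n}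
    (heq : ∀ j < i, π j = σ j) (h : lehmer π i = lehmer σ i) : ¬ π i < σ i := by
  intro hlt
  rw [lehmer_eq_card_unused, lehmer_eq_card_unused] at h
  refine (card_lt_card ?_).ne h
  rw [Finset.ssubset_iff_of_subset]
  · refine ⟨π i, ?_, by simp⟩
    simp only [mem_filter, mem_univ, true_and, hlt]
    intro j hj h
    rw [← heq j hj] at h
    exact hj.ne (π.injective h)
  · intro v
    simp only [mem_filter, mem_univ, true_and, and_imp]
    exact fun h1 h2 => ⟨h1.trans hlt, fun j hj => heq j hj ▸ h2 j hj⟩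

theorem lehmer_injective : Function.Injective (lehmer : Perm (Fin n) → Fin n → ℕ) := by
  intro π σ h
  ext1 i
  induction i using WellFoundedLT.induction with
  | ind i ih =>
    exact le_antisymm
      (not_lt.1 (not_apply_lt_of_lehmer_eq (fun j hj => (ih j hj).symm) (congrFun h i).symm))
      (not_lt.1 (not_apply_lt_of_lehmer_eq ih (congrFun h i)))

theorem exists_lehmer_eq {c : Fin n → ℕ} (hc : ∀ i, c i + i + 1 ≤ n) :
    ∃ π : Perm (Fin n), lehmer π = c := by
  let F : Perm (Fin n) → ∀ i : Fin n, Fin (n - i) :=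
    fun π i => ⟨lehmer π i, by have := lehmer_add_le π i; omega⟩
  have hF : Function.Injective F := fun π σ h =>
    lehmer_injective (funext fun i => congrArg Fin.val (congrFun h i))
  have hcard : Fintype.card (Perm (Fin n)) = Fintype.card (∀ i : Fin n, Fin (n - i)) := by
    rw [Fintype.card_perm, Fintype.card_pi, Fintype.card_fin]
    simp only [Fintype.card_fin]
    rw [Fin.prod_univ_eq_prod_range (fun i => n - i) n, ← Nat.descFactorial_eq_prod_range,
      Nat.descFactorial_self]
  obtain ⟨π, hπ⟩ := ((Fintype.bijective_iff_injective_and_card F).2 ⟨hF, hcard⟩).2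
    fun i => ⟨c i, by have := hc i; omega⟩
  exact ⟨π, funext fun i => congrArg Fin.val (congrFun hπ i)⟩

/-- `π` avoids the pattern 132. -/
def Avoids132 (π : Perm (Fin n)) : Prop :=
  ∀ ⦃i j l⦄, i < j → j < l → π i < π l → ¬ π l < π j

theorem avoids132_iff_antitone_lehmer (π : Perm (Fin n)) :
    Avoids132 π ↔ Antitone (lehmer π) := by
  constructor
  · intro h i j hij
    rcases hij.eq_or_lt with rfl | hij
    · rfl
    refine card_le_card fun l => ?_
    simp only [mem_filter, mem_univ, true_and, and_imp]
    refine fun h1 h2 => ⟨hij.trans h1, ?_⟩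
    by_contra! h3
    rcases h3.eq_or_lt with h3 | h3
    · exact (hij.trans h1).ne (π.injective h3)
    · exact h hij h1 h3 h2
  · intro h i j l hij hjl hil hlj
    obtain ⟨m, hm, hmax⟩ := exists_max_image ({m | m < j ∧ π m < π l} : Finset (Fin n)) id
      ⟨i, by simp [hij, hil]⟩
    simp only [mem_filter, mem_univ, true_and, and_imp, id] at hm hmax
    refine (h hm.1.le).not_gt (card_lt_card ?_)
    rw [Finset.ssubset_iff_of_subset]
    · exact ⟨l, by simp [hjl, hlj], by simp [hm.2.le]⟩
    · intro x
      simp only [mem_filter, mem_univ, true_and, and_imp]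
      refine fun h1 h2 => ⟨?_, h2.trans (hm.2.trans hlj)⟩
      by_contra! h3
      rcases h3.eq_or_lt with rfl | h3
      · exact lt_asymm h2 (hm.2.trans hlj)
      · exact (hmax x h3 (h2.trans hm.2)).not_gt h1

end LehmerCode

section Partition

variable {n k : ℕ}

theorem add_le_sum_of_antitone {c : Fin n → ℕ} (hc : Antitone c) {i : Fin n} (hi : c i ≠ 0) :
    c i + i ≤ ∑ j, c j := by
  have h : #(Iic i) * c i ≤ ∑ j, c j :=
    (card_nsmul_le_sum _ c _ fun j hj => hc (mem_Iic.1 hj)).trans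
      (sum_le_sum_of_subset (subset_univ _))
  rw [Fin.card_Iic] at h
  have : 1 ≤ c i := Nat.one_le_iff_ne_zero.2 hi
  nlinarith [Nat.mul_le_mul_left (i : ℕ) this]

theorem eq_of_antitone_of_map_eq {c d : Fin n → ℕ} (hc : Antitone c) (hd : Antitone d)
    (h : univ.val.map c = univ.val.map d) : c = d := by
  rw [Fin.univ_val_map, Fin.univ_val_map, Multiset.coe_eq_coe] at h
  exact List.ofFn_injective (h.eq_of_sortedGE hc.sortedGE_ofFn hd.sortedGE_ofFn)

theorem exists_antitone_map_eq (s : Multiset ℕ) (hs : s.card = n) :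
    ∃ c : Fin n → ℕ, Antitone c ∧ univ.val.map c = s := by
  subst hs
  have hlen : (s.sort (· ≥ ·)).length = s.card := Multiset.length_sort _
  refine ⟨fun i => (s.sort (· ≥ ·)).get (i.cast hlen.symm), ?_, ?_⟩
  · intro i j hij
    exact (List.sortedGE_iff_antitone_get.1
      (List.sortedGE_iff_pairwise.2 (Multiset.pairwise_sort s (· ≥ ·)))) hij
  · rw [Fin.univ_val_map]
    conv_rhs => rw [← Multiset.sort_eq s (· ≥ ·)]
    congr 1
    refine List.ext_get (by simp) fun m h1 h2 => by simp

theorem eq_of_filter_ne_zero_eq {s t : Multiset ℕ} (hcard : s.card = t.card)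
    (h : s.filter (· ≠ 0) = t.filter (· ≠ 0)) : s = t := by
  have key (u : Multiset ℕ) :
      u = Multiset.replicate (u.card - (u.filter (· ≠ 0)).card) 0 + u.filter (· ≠ 0) := by
    conv_lhs => rw [← Multiset.filter_add_not (· = 0) u]
    congr 1
    rw [Multiset.filter_eq']
    congr 1
    have h1 := congrArg Multiset.card (Multiset.filter_add_not (· = 0) u)
    rw [Multiset.card_add, Multiset.filter_eq', Multiset.card_replicate] at h1
    simp only [ne_eq]
    omega
  rw [key s, key t, h, hcard]

theorem card_le_of_partition (μ : Nat.Partition k) : μ.parts.card ≤ k := by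
  have := Multiset.card_nsmul_le_sum (s := μ.parts) (a := 1) fun x hx => μ.parts_pos hx
  simpa [μ.parts_sum] using this

theorem card_avoids132_eq_card_partition (hk : k < n) :
    Nat.card {π : Perm (Fin n) // invCount π = k ∧ Avoids132 π} = Nat.card (Nat.Partition k) := by
  have hsum (π : Perm (Fin n)) (h : invCount π = k) : (univ.val.map (lehmer π)).sum = k := by
    rw [← h, invCount_eq_sum_lehmer]; rfl
  refine Nat.card_congr (Equiv.ofBijective
    (fun π => Nat.Partition.ofSums k (univ.val.map (lehmer π.1)) (hsum π.1 π.2.1)) ⟨?_, ?_⟩)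
  · rintro ⟨π, hπ, hπ'⟩ ⟨σ, hσ, hσ'⟩ h
    rw [avoids132_iff_antitone_lehmer] at hπ' hσ'
    exact Subtype.ext (lehmer_injective (eq_of_antitone_of_map_eq hπ' hσ'
      (eq_of_filter_ne_zero_eq (by simp) (congrArg Nat.Partition.parts h))))
  · intro μ
    have hμ := card_le_of_partition μ
    obtain ⟨c, hc, hcs⟩ := exists_antitone_map_eq (n := n)
      (μ.parts + Multiset.replicate (n - μ.parts.card) 0)
      (by rw [Multiset.card_add, Multiset.card_replicate]; omega)
    have hck : ∑ j, c j = k := by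
      change (univ.val.map c).sum = k
      simp [hcs, μ.parts_sum]
    obtain ⟨π, rfl⟩ := exists_lehmer_eq (c := c) fun i => by
      by_cases hi : c i = 0
      · omega
      · have := add_le_sum_of_antitone hc hi
        omega
    refine ⟨⟨π, by rw [invCount_eq_sum_lehmer, hck], (avoids132_iff_antitone_lehmer π).2 hc⟩, ?_⟩
    ext1
    change Multiset.filter (· ≠ 0) (univ.val.map (lehmer π)) = μ.parts
    rw [hcs, Multiset.filter_add, Multiset.filter_eq_self.2 fun x hx => (μ.parts_pos hx).ne',
      Multiset.filter_eq_nil.2 fun x hx => by simp [Multiset.eq_of_mem_replicate hx], add_zero]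

end Partition

section Split

variable {n : ℕ}

theorem apply_lt_iff_of_split {π : Perm (Fin n)} {s : ℕ}
    (h : ∀ x : Fin n, (x : ℕ) < s → (π x : ℕ) < s) (x : Fin n) : (π x : ℕ) < s ↔ (x : ℕ) < s := by
  refine ⟨fun hx => ?_, h x⟩
  have := Perm.perm_symm_on_of_perm_on_finite (p := fun x : Fin n => (x : ℕ) < s) h hx
  simpa using this

theorem exists_split {π : Perm (Fin n)} {m : ℕ} (hm : invCount π < m) :
    ∃ s, 1 ≤ s ∧ s ≤ m ∧ ∀ x : Fin n, (x : ℕ) < s → (π x : ℕ) < s := by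
  by_contra! hno
  have hex (s : ℕ) (hs : s ∈ Icc 1 m) : ∃ x : Fin n, (x : ℕ) < s ∧ s ≤ (π x : ℕ) :=
    hno s (mem_Icc.1 hs).1 (mem_Icc.1 hs).2
  obtain ⟨x₀, -⟩ := hno 1 le_rfl (by omega)
  have : Nonempty (Fin n) := ⟨x₀⟩
  choose! f hf using hex
  have hcard := card_eq_sum_card_fiberwise (s := Icc 1 m) (f := f) (t := univ) (by simp)
  have hle : ∑ i, #{s ∈ Icc 1 m | f s = i} ≤ ∑ i, lehmer π i := by
    refine sum_le_sum fun i _ => ?_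
    calc #{s ∈ Icc 1 m | f s = i} ≤ #(Ioc (i : ℕ) (π i)) := by
          refine card_le_card fun s hs => ?_
          obtain ⟨hsm, rfl⟩ := mem_filter.1 hs
          exact mem_Ioc.2 (hf s hsm)
      _ ≤ lehmer π i := by
          have := apply_le_lehmer_add π i
          rw [Nat.card_Ioc]
          omega
  rw [← hcard, ← invCount_eq_sum_lehmer, Nat.card_Icc] at hle
  omega

theorem Avoids132.apply_eq_of_split {α : Perm (Fin n)} (hα : Avoids132 α) {s : ℕ} (hs : 0 < s)
    (h : ∀ x : Fin n, (x : ℕ) < s → (α x : ℕ) < s) {x : Fin n} (hx : s ≤ x) : α x = x := by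
  have hlt := apply_lt_iff_of_split h
  have hmono {i j : Fin n} (hi : s ≤ i) (hij : i < j) : α i < α j := by
    by_contra! hji
    have hne : α j ≠ α i := fun e => hij.ne' (α.injective e)
    refine hα (i := ⟨0, by omega⟩) (Fin.lt_def.2 (by simp; omega)) hij ?_ (lt_of_le_of_ne hji hne)
    have h0 := (hlt ⟨0, by omega⟩).2 hs
    have hj := (hlt j).not.2 (by rw [Fin.lt_def] at hij; omega)
    exact Fin.lt_def.2 (by omega)
  have hset : ({j | α j < α x} : Finset (Fin n)) = Iio x := by
    ext j
    simp only [mem_filter, mem_univ, true_and, mem_Iio]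
    constructor
    · intro hj
      by_contra! hxj
      rcases hxj.eq_or_lt with rfl | hxj
      · exact lt_irrefl _ hj
      · exact lt_asymm hj (hmono hx hxj)
    · intro hj
      by_cases hjs : (j : ℕ) < s
      · have h1 := (hlt j).2 hjs
        have h2 := (hlt x).not.2 (by omega)
        exact Fin.lt_def.2 (by omega)
      · exact hmono (by omega) hj
  have := card_apply_lt α (α x)
  rw [hset, Fin.card_Iio] at this
  exact Fin.ext this.symm

theorem Avoids132.apply_eq_of_invCount_lt {α : Perm (Fin n)} (hα : Avoids132 α) {x : Fin n}
    (hx : invCount α < x) : α x = x := by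
  obtain ⟨s, hs, hsm, h⟩ := exists_split hx
  exact hα.apply_eq_of_split hs h hsm

/-- The reverse-complement of a permutation. -/
def revComp (π : Perm (Fin n)) : Perm (Fin n) := Fin.revPerm * π * Fin.revPerm

theorem revComp_apply (π : Perm (Fin n)) (x : Fin n) : revComp π x = (π x.rev).rev := rfl

theorem revComp_revComp (π : Perm (Fin n)) : revComp (revComp π) = π := by
  ext1 x
  simp [revComp_apply]

theorem invCount_revComp (π : Perm (Fin n)) : invCount (revComp π) = invCount π := by
  rw [invCount_eq_card, invCount_eq_card]
  refine card_nbij' (fun ij => (ij.2.rev, ij.1.rev)) (fun ij => (ij.2.rev, ij.1.rev)) ?_ ?_ ?_ ?_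
  · intro ij; simp +contextual [revComp_apply]
  · intro ij; simp +contextual [revComp_apply]
  · intro ij; simp
  · intro ij; simp

/-- If `α` fixes everything from `s` on and `β` fixes everything below `s`,
then `α * β` is the direct sum of the two remaining parts. -/
structure SplitsAt (α β : Perm (Fin n)) (s : ℕ) : Prop where
  left : ∀ x : Fin n, s ≤ x → α x = x
  right : ∀ x : Fin n, (x : ℕ) < s → β x = x

namespace SplitsAt

variable {α β : Perm (Fin n)} {s : ℕ}

theorem left_lt_iff (h : SplitsAt α β s) (x : Fin n) : (α x : ℕ) < s ↔ (x : ℕ) < s := by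
  by_cases hx : (x : ℕ) < s
  · simp only [hx, iff_true]
    by_contra! h'
    have := α.injective (h.left _ h')
    omega
  · rw [h.left x (by omega)]

theorem right_lt_iff (h : SplitsAt α β s) (x : Fin n) : (β x : ℕ) < s ↔ (x : ℕ) < s := by
  refine apply_lt_iff_of_split (fun y hy => ?_) x
  rwa [h.right y hy]

theorem mul_apply_of_lt (h : SplitsAt α β s) {x : Fin n} (hx : (x : ℕ) < s) :
    (α * β) x = α x := by
  rw [Perm.mul_apply, h.right x hx]

theorem mul_apply_of_le (h : SplitsAt α β s) {x : Fin n} (hx : s ≤ x) : (α * β) x = β x := by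
  rw [Perm.mul_apply, h.left]
  have := (h.right_lt_iff x).not.2 (by omega)
  omega

theorem mul_lt_iff (h : SplitsAt α β s) (x : Fin n) : ((α * β) x : ℕ) < s ↔ (x : ℕ) < s := by
  rw [Perm.mul_apply, h.left_lt_iff, h.right_lt_iff]

theorem invCount_mul (h : SplitsAt α β s) : invCount (α * β) = invCount α + invCount β := by
  rw [invCount_eq_card, invCount_eq_card, invCount_eq_card, ← card_union_of_disjoint]
  · congr 1
    ext ⟨a, b⟩
    simp only [mem_filter, mem_univ, true_and, mem_union, Fin.lt_def]
    have ha := h.left_lt_iff a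
    have hb := h.left_lt_iff b
    have ha' := h.right_lt_iff a
    have hb' := h.right_lt_iff b
    rcases lt_or_ge (a : ℕ) s with has | has <;> rcases lt_or_ge (b : ℕ) s with hbs | hbs
    · rw [h.mul_apply_of_lt has, h.mul_apply_of_lt hbs, h.right a has, h.right b hbs]
      omega
    · rw [h.mul_apply_of_lt has, h.mul_apply_of_le hbs, h.right a has, h.left b hbs]
      omega
    · omega
    · rw [h.mul_apply_of_le has, h.mul_apply_of_le hbs, h.left a has, h.left b hbs]
      omega
  · rw [Finset.disjoint_left]
    rintro ⟨a, b⟩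
    simp only [mem_filter, mem_univ, true_and, Fin.lt_def, not_and]
    rintro ⟨h1, h2⟩ -
    have hb : (b : ℕ) < s := by
      by_contra! hb
      rw [h.left b hb] at h2
      have ha : ¬ (a : ℕ) < s := by rw [← h.left_lt_iff]; omega
      rw [h.left a (by omega)] at h2
      omega
    rw [h.right b hb, h.right a (by omega)]
    omega

/-- The left factor is determined by the product when it avoids 132. -/
theorem left_eq_of_le {α' β' : Perm (Fin n)} {s' : ℕ} (h : SplitsAt α β s)
    (h' : SplitsAt α' β' s') (hs : 0 < s) (hss : s ≤ s') (hα' : Avoids132 α')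
    (heq : α * β = α' * β') : α = α' := by
  have hlow {x : Fin n} (hx : (x : ℕ) < s) : α' x = α x := by
    rw [← h.mul_apply_of_lt hx, heq, h'.mul_apply_of_lt (by omega)]
  ext1 x
  rcases lt_or_ge (x : ℕ) s with hx | hx
  · exact (hlow hx).symm
  · rw [h.left x hx, hα'.apply_eq_of_split hs (fun y hy => ?_) hx]
    rw [hlow hy]
    exact (h.left_lt_iff y).2 hy

end SplitsAt

theorem splitsAt_of_avoids132 {α γ : Perm (Fin n)} (hα : Avoids132 α) (hγ : Avoids132 γ)
    (hn : invCount α + invCount γ + 2 ≤ n) : SplitsAt α (revComp γ) (invCount α + 1) where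
  left x hx := hα.apply_eq_of_invCount_lt (by omega)
  right x hx := by
    rw [revComp_apply, hγ.apply_eq_of_invCount_lt (by rw [Fin.val_rev]; omega), Fin.rev_rev]

theorem avoids_p1324_iff (π : Perm (Fin n)) :
    Avoids π p1324 ↔ ∀ a b c d, a < b → b < c → c < d → π a < π c → π c < π b → ¬ π b < π d := by
  constructor
  · intro h a b c d hab hbc hcd h1 h2 h3
    refine h ⟨![a, b, c, d], ?_, ?_⟩
    · rw [Fin.strictMono_iff_lt_succ]
      intro i
      fin_cases i <;> simpa
    · intro i j
      fin_cases i <;> fin_cases j <;> simp [p1324] <;> order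
  · rintro h ⟨f, hf, hp⟩
    exact h (f 0) (f 1) (f 2) (f 3) (hf (by decide)) (hf (by decide)) (hf (by decide))
      ((hp _ _).2 (by decide)) ((hp _ _).2 (by decide)) ((hp _ _).2 (by decide))

theorem SplitsAt.avoids_p1324 {α γ : Perm (Fin n)} {s : ℕ} (h : SplitsAt α (revComp γ) s)
    (hα : Avoids132 α) (hγ : Avoids132 γ) : Avoids (α * revComp γ) p1324 := by
  rw [avoids_p1324_iff]
  intro a b c d hab hbc hcd h1 h2 h3
  have hb := h.mul_lt_iff b
  have hc := h.mul_lt_iff c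
  simp only [Fin.lt_def] at hab hbc hcd h1 h2 h3
  rcases lt_or_ge (c : ℕ) s with hcs | hcs
  · rw [h.mul_apply_of_lt hcs] at h1 h2
    rw [h.mul_apply_of_lt (by omega)] at h1 h2
    exact hα hab hbc h1 h2
  · have hbs : s ≤ b := by omega
    rw [h.mul_apply_of_le hbs] at h2 h3
    rw [h.mul_apply_of_le (by omega)] at h2 h3
    exact hγ (i := d.rev) (j := c.rev) (l := b.rev) (Fin.rev_lt_rev.2 hcd) (Fin.rev_lt_rev.2 hbc)
      (Fin.rev_lt_rev.1 h3) (Fin.rev_lt_rev.1 h2)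

/-- A permutation preserving the positions below `s` factors as a direct sum. -/
theorem exists_splitsAt {π : Perm (Fin n)} {s : ℕ}
    (h : ∀ x : Fin n, (x : ℕ) < s → (π x : ℕ) < s) :
    ∃ α β : Perm (Fin n), SplitsAt α β s ∧ α * β = π := by
  have hlt := apply_lt_iff_of_split h
  let α := Perm.ofSubtype (π.subtypePerm (p := fun x : Fin n => (x : ℕ) < s) hlt)
  have hα {x : Fin n} (hx : (x : ℕ) < s) : α x = π x := by
    simp [α, Perm.ofSubtype_apply_of_mem (p := fun x : Fin n => (x : ℕ) < s) _ hx]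
  have hα' {x : Fin n} (hx : s ≤ x) : α x = x :=
    Perm.ofSubtype_apply_of_not_mem (p := fun x : Fin n => (x : ℕ) < s) _ (by simpa using hx)
  refine ⟨α, α⁻¹ * π, ⟨fun x hx => hα' hx, fun x hx => ?_⟩, by simp⟩
  rw [Perm.mul_apply, ← hα hx]
  exact α.symm_apply_apply x

theorem SplitsAt.avoids132_left {α β : Perm (Fin n)} {s : ℕ} (h : SplitsAt α β s) (hs : s < n)
    (hav : Avoids (α * β) p1324) : Avoids132 α := by
  rw [avoids_p1324_iff] at hav
  intro i j l hij hjl h1 h2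
  have hj := h.left_lt_iff j
  simp only [Fin.lt_def] at hij hjl h1 h2
  have hl : (l : ℕ) < s := by
    by_contra! hl
    rw [h.left l hl] at h2
    rcases lt_or_ge (j : ℕ) s with hjs | hjs
    · omega
    · rw [h.left j hjs] at h2; omega
  refine hav i j l ⟨s, hs⟩ hij hjl hl ?_ ?_ ?_
  · rwa [h.mul_apply_of_lt hl, h.mul_apply_of_lt (by omega)]
  · rwa [h.mul_apply_of_lt hl, h.mul_apply_of_lt (by omega)]
  · have h3 := (h.mul_lt_iff ⟨s, hs⟩).not.2 (by simp)
    have h4 := (h.mul_lt_iff j).2 (by omega)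
    exact Fin.lt_def.2 (by omega)

theorem SplitsAt.avoids132_right {α β : Perm (Fin n)} {s : ℕ} (h : SplitsAt α β s) (hs : 0 < s)
    (hav : Avoids (α * β) p1324) : Avoids132 (revComp β) := by
  rw [avoids_p1324_iff] at hav
  intro i j l hij hjl h1 h2
  rw [revComp_apply, revComp_apply, Fin.rev_lt_rev] at h1 h2
  rw [← Fin.rev_lt_rev] at hij hjl
  generalize i.rev = i at *
  generalize j.rev = j at *
  generalize l.rev = l at *
  have hj := h.right_lt_iff j
  simp only [Fin.lt_def] at hij hjl h1 h2
  have hl : s ≤ l := by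
    by_contra! hl
    rw [h.right l hl] at h2
    rcases lt_or_ge (j : ℕ) s with hjs | hjs
    · rw [h.right j hjs] at h2; omega
    · omega
  refine hav ⟨0, by omega⟩ l j i (Fin.lt_def.2 (by simp; omega)) hjl hij ?_ ?_ ?_
  · have h3 := (h.mul_lt_iff ⟨0, by omega⟩).2 hs
    have h4 := (h.mul_lt_iff j).not.2 (by omega)
    exact Fin.lt_def.2 (by omega)
  · rwa [h.mul_apply_of_le hl, h.mul_apply_of_le (by omega)]
  · rwa [h.mul_apply_of_le hl, h.mul_apply_of_le (by omega)]

end Split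

theorem card_avoids_p1324_eq_card_pairs (k n : ℕ) (hn : k + 2 ≤ n) :
    Nat.card {π : Perm (Fin n) // invCount π = k ∧ Avoids π p1324} =
      Nat.card {q : Perm (Fin n) × Perm (Fin n) //
        invCount q.1 + invCount q.2 = k ∧ Avoids132 q.1 ∧ Avoids132 q.2} := by
  have hsplit (q : Perm (Fin n) × Perm (Fin n))
      (hq : invCount q.1 + invCount q.2 = k ∧ Avoids132 q.1 ∧ Avoids132 q.2) :
      SplitsAt q.1 (revComp q.2) (invCount q.1 + 1) :=
    splitsAt_of_avoids132 hq.2.1 hq.2.2 (by omega)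
  refine (Nat.card_congr (Equiv.ofBijective (fun q => ⟨q.1.1 * revComp q.1.2,
    by rw [(hsplit q.1 q.2).invCount_mul, invCount_revComp, q.2.1],
    (hsplit q.1 q.2).avoids_p1324 q.2.2.1 q.2.2.2⟩) ⟨?_, ?_⟩)).symm
  · rintro ⟨q, hq⟩ ⟨r, hr⟩ h
    have heq : q.1 * revComp q.2 = r.1 * revComp r.2 := congrArg Subtype.val h
    have h1 : q.1 = r.1 := by
      rcases le_total (invCount q.1 + 1) (invCount r.1 + 1) with hle | hle
      · exact (hsplit q hq).left_eq_of_le (hsplit r hr) (by omega) hle hr.2.1 heq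
      · exact ((hsplit r hr).left_eq_of_le (hsplit q hq) (by omega) hle hq.2.1 heq.symm).symm
    rw [h1] at heq
    have h2 : q.2 = r.2 := by
      rw [← revComp_revComp q.2, mul_left_cancel heq, revComp_revComp]
    exact Subtype.ext (Prod.ext h1 h2)
  · rintro ⟨π, hπ, hav⟩
    obtain ⟨s, hs, hsk, h⟩ := exists_split (π := π) (m := k + 1) (by omega)
    obtain ⟨α, β, hαβ, rfl⟩ := exists_splitsAt h
    refine ⟨⟨(α, revComp β), ?_, hαβ.avoids132_left (by omega) hav, hαβ.avoids132_right hs hav⟩, ?_⟩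
    · rw [invCount_revComp, ← hαβ.invCount_mul, hπ]
    · simp [revComp_revComp]

/-- For every `k ≥ 0` and every `n ≥ k + 2`, the number of permutations of length `n`
with exactly `k` inversions avoiding 1324 equals `Σ_{i=0}^{k} p(i)·p(k−i)`, where `p(j)`
is the number of integer partitions of `j`. -/
theorem av_1324_eq (k n : ℕ) (hn : k + 2 ≤ n) :
    Nat.card {π : Equiv.Perm (Fin n) // invCount π = k ∧ Avoids π p1324} =
      ∑ i ∈ Finset.range (k + 1),
        Nat.card (Nat.Partition i) * Nat.card (Nat.Partition (k - i)) := by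
  classical
  rw [card_avoids_p1324_eq_card_pairs k n hn, Nat.card_eq_fintype_card, Fintype.card_subtype,
    card_eq_sum_card_fiberwise (f := fun q => invCount q.1) (t := range (k + 1))
      fun q hq => by simp at hq ⊢; omega]
  refine sum_congr rfl fun i hi => ?_
  rw [mem_range] at hi
  rw [← card_avoids132_eq_card_partition (n := n) (k := i) (by omega),
    ← card_avoids132_eq_card_partition (n := n) (k := k - i) (by omega),
    Nat.card_eq_fintype_card, Nat.card_eq_fintype_card, Fintype.card_subtype,
    Fintype.card_subtype, ← card_product]
  congr 1
  ext q
  simp only [mem_filter, mem_univ, true_and, mem_product]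
  constructor
  · rintro ⟨⟨h1, h2, h3⟩, rfl⟩
    exact ⟨⟨rfl, h2⟩, by omega, h3⟩
  · rintro ⟨⟨rfl, h2⟩, h1, h3⟩
    exact ⟨⟨by omega, h2, h3⟩, rfl⟩
end

section
/- For every k ≥ 0 and every n with 2n ≥ k + 7, the number of permutations of length n with exactly k inversions avoiding both 1324 and 1342 is at most the number of permutations of length n+1 with exactly k inversions avoiding both 1324 and 1342. -/
def p1342 : Equiv.Perm (Fin 4) := ⟨![0,2,3,1], ![0,3,1,2], by decide, by decide⟩

/-- The entry at position `i` lies strictly between the entries at positions `j` and `k`. -/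
def IsBetween {n : ℕ} (π : Equiv.Perm (Fin n)) (i j k : Fin n) : Prop :=
  (π j < π i ∧ π i < π k) ∨ (π k < π i ∧ π i < π j)

/-- The entries of `π` with value at least `t` avoid the patterns 213 and 231. -/
def TopAvoids {n : ℕ} (π : Equiv.Perm (Fin n)) (t : ℕ) : Prop :=
  ∀ i j k : Fin n, i < j → j < k → t ≤ (π i : ℕ) → t ≤ (π j : ℕ) → t ≤ (π k : ℕ) →
    ¬ IsBetween π i j k

/-- To the right of every entry, the larger entries avoid the patterns 213 and 231. -/
def LargerAvoids {n : ℕ} (π : Equiv.Perm (Fin n)) : Prop :=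
  ∀ h i j k : Fin n, h < i → i < j → j < k → π h < π i → π h < π j → π h < π k →
    ¬ IsBetween π i j k

theorem contains_p1324_iff {n : ℕ} (π : Equiv.Perm (Fin n)) :
    Contains π p1324 ↔
      ∃ h i j k : Fin n, h < i ∧ i < j ∧ j < k ∧ π h < π j ∧ π j < π i ∧ π i < π k := by
  constructor
  · rintro ⟨f, hf, hp⟩
    exact ⟨f 0, f 1, f 2, f 3, hf (by decide), hf (by decide), hf (by decide),
      (hp 0 2).2 (by decide), (hp 2 1).2 (by decide), (hp 1 3).2 (by decide)⟩
  · rintro ⟨h, i, j, k, hhi, hij, hjk, h1, h2, h3⟩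
    refine ⟨![h, i, j, k], ?_, ?_⟩
    · rw [Fin.strictMono_iff_lt_succ]
      intro a
      fin_cases a <;> simpa
    · intro a b
      fin_cases a <;> fin_cases b <;> simp [p1324] <;> order

theorem contains_p1342_iff {n : ℕ} (π : Equiv.Perm (Fin n)) :
    Contains π p1342 ↔
      ∃ h i j k : Fin n, h < i ∧ i < j ∧ j < k ∧ π h < π k ∧ π k < π i ∧ π i < π j := by
  constructor
  · rintro ⟨f, hf, hp⟩
    exact ⟨f 0, f 1, f 2, f 3, hf (by decide), hf (by decide), hf (by decide),
      (hp 0 3).2 (by decide), (hp 3 1).2 (by decide), (hp 1 2).2 (by decide)⟩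
  · rintro ⟨h, i, j, k, hhi, hij, hjk, h1, h2, h3⟩
    refine ⟨![h, i, j, k], ?_, ?_⟩
    · rw [Fin.strictMono_iff_lt_succ]
      intro a
      fin_cases a <;> simpa
    · intro a b
      fin_cases a <;> fin_cases b <;> simp [p1342] <;> order

theorem avoids_iff_largerAvoids {n : ℕ} (π : Equiv.Perm (Fin n)) :
    Avoids π p1324 ∧ Avoids π p1342 ↔ LargerAvoids π := by
  unfold Avoids
  rw [contains_p1324_iff, contains_p1342_iff]
  constructor
  · rintro ⟨h1, h2⟩ h i j k hhi hij hjk hi hj hk (⟨ha, hb⟩ | ⟨ha, hb⟩)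
    · exact h1 ⟨h, i, j, k, hhi, hij, hjk, hj, ha, hb⟩
    · exact h2 ⟨h, i, j, k, hhi, hij, hjk, hk, ha, hb⟩
  · intro H
    constructor
    · rintro ⟨h, i, j, k, hhi, hij, hjk, h1, h2, h3⟩
      exact H h i j k hhi hij hjk (h1.trans h2) h1 ((h1.trans h2).trans h3) (Or.inl ⟨h2, h3⟩)
    · rintro ⟨h, i, j, k, hhi, hij, hjk, h1, h2, h3⟩
      exact H h i j k hhi hij hjk (h1.trans h2) ((h1.trans h2).trans h3) h1 (Or.inr ⟨h2, h3⟩)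

theorem exists_permTail {n : ℕ} (π : Equiv.Perm (Fin (n + 1))) :
    ∃ σ : Equiv.Perm (Fin n), ∀ i, (π 0).succAbove (σ i) = π i.succ := by
  have hne : ∀ i : Fin n, ∃ j, (π 0).succAbove j = π i.succ := fun i =>
    Fin.exists_succAbove_eq (fun e => Fin.succ_ne_zero i (π.injective e))
  choose f hf using hne
  have hinj : Function.Injective f := fun i j e =>
    Fin.succ_injective n (π.injective (by rw [← hf i, ← hf j, e]))
  exact ⟨Equiv.ofBijective f (Finite.injective_iff_bijective.1 hinj), hf⟩

/-- The standardization of `π` with its first entry removed. -/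
noncomputable def permTail {n : ℕ} (π : Equiv.Perm (Fin (n + 1))) : Equiv.Perm (Fin n) :=
  (exists_permTail π).choose

theorem succAbove_permTail {n : ℕ} (π : Equiv.Perm (Fin (n + 1))) (i : Fin n) :
    (π 0).succAbove (permTail π i) = π i.succ :=
  (exists_permTail π).choose_spec i

theorem perm_ext_of_zero_of_permTail {n : ℕ} {π τ : Equiv.Perm (Fin (n + 1))}
    (h0 : π 0 = τ 0) (ht : permTail π = permTail τ) : π = τ := by
  ext i
  refine Fin.cases ?_ (fun i => ?_) i
  · rw [h0]
  · rw [← succAbove_permTail, ← succAbove_permTail, h0, ht]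

theorem exists_zero_permTail {n : ℕ} (a : Fin (n + 1)) (σ : Equiv.Perm (Fin n)) :
    ∃ π : Equiv.Perm (Fin (n + 1)), π 0 = a ∧ permTail π = σ := by
  have hinj : Function.Injective
      (Fin.cons a (fun i => a.succAbove (σ i)) : Fin (n + 1) → Fin (n + 1)) := by
    rw [Fin.cons_injective_iff]
    refine ⟨?_, (Fin.succAbove_right_injective).comp σ.injective⟩
    rintro ⟨i, hi⟩
    exact Fin.succAbove_ne a _ hi
  refine ⟨Equiv.ofBijective _ (Finite.injective_iff_bijective.1 hinj), rfl, ?_⟩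
  refine Equiv.ext fun i => Fin.succAbove_right_injective (p := a) ?_
  exact succAbove_permTail (Equiv.ofBijective _ (Finite.injective_iff_bijective.1 hinj)) i

theorem invCount_eq_sum {n : ℕ} (π : Equiv.Perm (Fin n)) :
    invCount π = ∑ i, ∑ j, if i < j ∧ π j < π i then 1 else 0 := by
  classical
  rw [invCount, Nat.card_eq_fintype_card, Fintype.card_subtype, Finset.card_filter,
    Fintype.sum_prod_type]

theorem invCount_succ {n : ℕ} (π : Equiv.Perm (Fin (n + 1))) :
    invCount π = (π 0 : ℕ) + invCount (permTail π) := by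
  rw [invCount_eq_sum, invCount_eq_sum, Fin.sum_univ_succ]
  congr 1
  · rw [Fin.sum_univ_succ]
    simp only [lt_self_iff_false, false_and, if_false, zero_add, Fin.succ_pos, true_and,
      ← succAbove_permTail, Fin.succAbove_lt_iff_castSucc_lt]
    rw [Equiv.sum_comp (permTail π) (fun x => if x.castSucc < π 0 then 1 else 0),
      ← Finset.card_filter]
    simp only [Fin.lt_def, Fin.val_castSucc]
    rw [Fin.card_filter_val_lt, min_eq_right (Nat.le_of_lt_succ (π 0).isLt)]
  · refine Finset.sum_congr rfl fun i _ => ?_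
    rw [Fin.sum_univ_succ]
    simp [← succAbove_permTail]

theorem isBetween_succ {n : ℕ} (π : Equiv.Perm (Fin (n + 1))) (i j k : Fin n) :
    IsBetween π i.succ j.succ k.succ ↔ IsBetween (permTail π) i j k := by
  simp [IsBetween, ← succAbove_permTail]

theorem lt_succ_iff_le_permTail {n : ℕ} (π : Equiv.Perm (Fin (n + 1))) (i : Fin n) :
    π 0 < π i.succ ↔ (π 0 : ℕ) ≤ permTail π i := by
  rw [← succAbove_permTail, Fin.lt_succAbove_iff_le_castSucc, Fin.le_def, Fin.val_castSucc]

theorem largerAvoids_succ_iff {n : ℕ} (π : Equiv.Perm (Fin (n + 1))) :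
    LargerAvoids π ↔ LargerAvoids (permTail π) ∧ TopAvoids (permTail π) (π 0) := by
  constructor
  · intro H
    constructor
    · intro h i j k hhi hij hjk hi hj hk
      rw [← isBetween_succ]
      apply H h.succ <;> simpa [← succAbove_permTail]
    · intro i j k hij hjk hi hj hk
      rw [← isBetween_succ]
      exact H 0 _ _ _ (Fin.succ_pos i) (by simpa) (by simpa)
        ((lt_succ_iff_le_permTail π i).2 hi) ((lt_succ_iff_le_permTail π j).2 hj)
        ((lt_succ_iff_le_permTail π k).2 hk)
  · rintro ⟨H, T⟩ h i j k hhi hij hjk hi hj hk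
    obtain ⟨i, rfl⟩ := Fin.exists_succ_eq.2 (Fin.ne_zero_of_lt hhi)
    obtain ⟨j, rfl⟩ := Fin.exists_succ_eq.2 (Fin.ne_zero_of_lt hij)
    obtain ⟨k, rfl⟩ := Fin.exists_succ_eq.2 (Fin.ne_zero_of_lt hjk)
    rw [isBetween_succ]
    rw [Fin.succ_lt_succ_iff] at hij hjk
    rcases Fin.eq_zero_or_eq_succ h with rfl | ⟨h, rfl⟩
    · rw [lt_succ_iff_le_permTail] at hi hj hk
      exact T i j k hij hjk hi hj hk
    · simp only [← succAbove_permTail, Fin.succAbove_lt_succAbove_iff] at hi hj hk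
      exact H h i j k (by simpa using hhi) hij hjk hi hj hk

theorem topAvoids_of_zero_eq_last {n : ℕ} (π : Equiv.Perm (Fin (n + 1)))
    (h0 : π 0 = Fin.last n) (t : ℕ) : TopAvoids π t ↔ TopAvoids (permTail π) t := by
  have hv : ∀ i : Fin n, (π i.succ : ℕ) = permTail π i := fun i => by
    rw [← succAbove_permTail, h0, Fin.succAbove_last, Fin.val_castSucc]
  constructor
  · intro H i j k hij hjk hi hj hk
    rw [← isBetween_succ]
    exact H _ _ _ (by simpa) (by simpa) (by rwa [hv]) (by rwa [hv]) (by rwa [hv])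
  · intro H i j k hij hjk hi hj hk
    obtain ⟨j, rfl⟩ := Fin.exists_succ_eq.2 (Fin.ne_zero_of_lt hij)
    obtain ⟨k, rfl⟩ := Fin.exists_succ_eq.2 (Fin.ne_zero_of_lt hjk)
    rcases Fin.eq_zero_or_eq_succ i with rfl | ⟨i, rfl⟩
    · rintro (⟨-, hb⟩ | ⟨-, hb⟩) <;> rw [h0] at hb <;> exact absurd hb (Fin.le_last _).not_gt
    · rw [isBetween_succ]
      rw [hv] at hi hj hk
      exact H i j k (by simpa using hij) (by simpa using hjk) hi hj hk

theorem topAvoids_of_zero_ne_last {n : ℕ} (π : Equiv.Perm (Fin (n + 1)))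
    (h0 : π 0 ≠ Fin.last n) (hT : TopAvoids (permTail π) (π 0)) (t : ℕ) :
    TopAvoids π t ↔ (π 0 : ℕ) ≤ t := by
  constructor
  · intro H
    by_contra! ht
    obtain ⟨p, hp⟩ := π.surjective ⟨t, ht.trans (π 0).isLt⟩
    obtain ⟨q, hq⟩ := π.surjective (Fin.last n)
    have hpt : (π p : ℕ) = t := by rw [hp]
    have hlp : π p < π 0 := by rw [Fin.lt_def, hpt]; exact ht
    have hlq : π 0 < π q := by rw [hq]; exact Fin.lt_last_iff_ne_last.2 h0
    have hp0 : 0 < p := Fin.pos_iff_ne_zero.2 (by rintro rfl; exact lt_irrefl _ hlp)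
    have hq0 : 0 < q := Fin.pos_iff_ne_zero.2 (by rintro rfl; exact lt_irrefl _ hlq)
    have hqt : t ≤ (π q : ℕ) := ht.le.trans (Fin.le_def.1 hlq.le)
    rcases lt_trichotomy p q with hpq | rfl | hpq
    · exact H 0 p q hp0 hpq ht.le hpt.ge hqt (Or.inl ⟨hlp, hlq⟩)
    · exact lt_asymm hlp hlq
    · exact H 0 q p hq0 hpq ht.le hqt hpt.ge (Or.inr ⟨hlp, hlq⟩)
  · intro ht i j k hij hjk hi hj hk
    obtain ⟨j, rfl⟩ := Fin.exists_succ_eq.2 (Fin.ne_zero_of_lt hij)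
    obtain ⟨k, rfl⟩ := Fin.exists_succ_eq.2 (Fin.ne_zero_of_lt hjk)
    rcases Fin.eq_zero_or_eq_succ i with rfl | ⟨i, rfl⟩
    · rintro (⟨ha, -⟩ | ⟨ha, -⟩) <;> rw [Fin.lt_def] at ha <;> omega
    · have hle : ∀ x : Fin n, t ≤ (π x.succ : ℕ) → (π 0 : ℕ) ≤ permTail π x := fun x hx =>
        (lt_succ_iff_le_permTail π x).1 (lt_of_le_of_ne (Fin.le_def.2 (ht.trans hx))
          (fun e => Fin.succ_ne_zero x (π.injective e).symm))
      rw [isBetween_succ]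
      exact hT i j k (by simpa using hij) (by simpa using hjk) (hle i hi) (hle j hj) (hle k hk)

/-- The Lehmer code of `π`: for each position, the number of smaller entries to its right. -/
noncomputable def lehmerCode : (n : ℕ) → Equiv.Perm (Fin n) → List ℕ
  | 0, _ => []
  | n + 1, π => (π 0 : ℕ) :: lehmerCode n (permTail π)

/-- The leftmost entry of a code that is smaller than the number of entries to its right, or `0`
if there is no such entry. -/
def lastNonmax : List ℕ → ℕ
  | [] => 0
  | c :: l => if c = l.length then lastNonmax l else c

/-- Codes whose entries are bounded by the number of entries to their right, and in which the
entries that do not attain this bound weakly decrease from left to right. -/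
def IsAvoiderCode : List ℕ → Prop
  | [] => True
  | c :: l => IsAvoiderCode l ∧ lastNonmax l ≤ c ∧ c ≤ l.length

/-- Replace every nonmaximal entry of a code by the next nonmaximal entry to its right, and the
rightmost one by `0`. -/
def shiftNonmax : List ℕ → List ℕ
  | [] => []
  | c :: l => (if c = l.length then c else lastNonmax l) :: shiftNonmax l

theorem length_lehmerCode (n : ℕ) (π : Equiv.Perm (Fin n)) : (lehmerCode n π).length = n := by
  induction n with
  | zero => rfl
  | succ n ih => simp [lehmerCode, ih]

theorem sum_lehmerCode (n : ℕ) (π : Equiv.Perm (Fin n)) : (lehmerCode n π).sum = invCount π := by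
  induction n with
  | zero => simp [lehmerCode, invCount_eq_sum]
  | succ n ih => simp [lehmerCode, ih, invCount_succ π]

theorem lehmerCode_injective (n : ℕ) : Function.Injective (lehmerCode n) := by
  induction n with
  | zero => exact fun _ _ _ => Subsingleton.elim _ _
  | succ n ih =>
    intro π τ h
    rw [lehmerCode, lehmerCode, List.cons.injEq] at h
    exact perm_ext_of_zero_of_permTail (Fin.ext h.1) (ih h.2)

theorem exists_lehmerCode_eq (n : ℕ) (l : List ℕ) (hn : l.length = n) (hl : IsAvoiderCode l) :
    ∃ π, lehmerCode n π = l := by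
  induction l generalizing n with
  | nil => subst hn; exact ⟨1, rfl⟩
  | cons c l ih =>
    subst hn
    obtain ⟨σ, hσ⟩ := ih _ rfl hl.1
    obtain ⟨π, h0, ht⟩ := exists_zero_permTail ⟨c, Nat.lt_succ_of_le hl.2.2⟩ σ
    exact ⟨π, by simp only [List.length_cons, lehmerCode, h0, ht, hσ]⟩

theorem topAvoids_iff_lastNonmax_le (n : ℕ) (π : Equiv.Perm (Fin n)) (h : LargerAvoids π) (t : ℕ) :
    TopAvoids π t ↔ lastNonmax (lehmerCode n π) ≤ t := by
  induction n with
  | zero => exact ⟨fun _ => Nat.zero_le t, fun _ i => i.elim0⟩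
  | succ n ih =>
    rw [largerAvoids_succ_iff] at h
    rw [lehmerCode, lastNonmax, length_lehmerCode]
    by_cases h0 : π 0 = Fin.last n
    · rw [topAvoids_of_zero_eq_last π h0, ih _ h.1, if_pos (by rw [h0, Fin.val_last])]
    · rw [topAvoids_of_zero_ne_last π h0 h.2, if_neg (by simpa [Fin.ext_iff] using h0)]

theorem largerAvoids_iff_isAvoiderCode (n : ℕ) (π : Equiv.Perm (Fin n)) :
    LargerAvoids π ↔ IsAvoiderCode (lehmerCode n π) := by
  induction n with
  | zero => exact ⟨fun _ => trivial, fun _ i => i.elim0⟩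
  | succ n ih =>
    rw [largerAvoids_succ_iff, lehmerCode, IsAvoiderCode, length_lehmerCode, ← ih]
    refine and_congr_right fun h => ?_
    rw [topAvoids_iff_lastNonmax_le n _ h]
    exact (and_iff_left (Nat.le_of_lt_succ (π 0).isLt)).symm

theorem length_shiftNonmax (l : List ℕ) : (shiftNonmax l).length = l.length := by
  induction l with
  | nil => rfl
  | cons c l ih => simp [shiftNonmax, ih]

theorem lastNonmax_add_sum_shiftNonmax (l : List ℕ) :
    lastNonmax l + (shiftNonmax l).sum = l.sum := by
  induction l with
  | nil => rfl
  | cons c l ih =>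
    simp only [lastNonmax, shiftNonmax, List.sum_cons]
    split_ifs <;> omega

theorem lastNonmax_le_length {l : List ℕ} (hl : IsAvoiderCode l) : lastNonmax l ≤ l.length := by
  induction l with
  | nil => exact le_rfl
  | cons c l ih =>
    have := ih hl.1
    have := hl.2.2
    simp only [lastNonmax, List.length_cons]
    split_ifs <;> omega

theorem isAvoiderCode_shiftNonmax {l : List ℕ} (hl : IsAvoiderCode l) :
    IsAvoiderCode (shiftNonmax l) ∧ lastNonmax (shiftNonmax l) ≤ lastNonmax l := by
  induction l with
  | nil => exact ⟨trivial, le_rfl⟩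
  | cons c l ih =>
    obtain ⟨h1, h2, h3⟩ := hl
    obtain ⟨i1, i2⟩ := ih h1
    simp only [shiftNonmax, IsAvoiderCode, lastNonmax, length_shiftNonmax]
    by_cases hc : c = l.length
    · simp only [hc, if_true]
      exact ⟨⟨i1, i2.trans (hc ▸ h2), le_rfl⟩, i2⟩
    · simp only [hc, if_false]
      rw [if_neg (by omega)]
      exact ⟨⟨i1, i2, by omega⟩, h2⟩

theorem eq_of_shiftNonmax_eq {l l' : List ℕ} (hl : IsAvoiderCode l) (hl' : IsAvoiderCode l')
    (hs : shiftNonmax l = shiftNonmax l') (ht : lastNonmax l = lastNonmax l') : l = l' := by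
  induction l generalizing l' with
  | nil =>
    cases l' with
    | nil => rfl
    | cons c' l' => simp [shiftNonmax] at hs
  | cons c l ih =>
    cases l' with
    | nil => simp [shiftNonmax] at hs
    | cons c' l' =>
      obtain ⟨h1, h2, h3⟩ := hl
      obtain ⟨h1', h2', h3'⟩ := hl'
      simp only [shiftNonmax, List.cons.injEq] at hs
      obtain ⟨hc, hs⟩ := hs
      have hlen : l.length = l'.length := by
        rw [← length_shiftNonmax l, hs, length_shiftNonmax]
      simp only [lastNonmax] at ht
      have key : c = c' ∧ lastNonmax l = lastNonmax l' := by
        split_ifs at hc ht <;> omega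
      rw [key.1, ih h1 h1' hs key.2]

/-- For every `k ≥ 0` and every `n` with `2n ≥ k + 7`, the number of permutations of
length `n` with exactly `k` inversions avoiding both 1324 and 1342 is at most the
corresponding number for length `n + 1`. -/
theorem half_monotone_1324_1342 (k n : ℕ) (h : k + 7 ≤ 2 * n) :
    Nat.card {π : Equiv.Perm (Fin n) // invCount π = k ∧
      Avoids π p1324 ∧ Avoids π p1342} ≤
    Nat.card {π : Equiv.Perm (Fin (n + 1)) // invCount π = k ∧
      Avoids π p1324 ∧ Avoids π p1342} := by
  have key : ∀ π : {π : Equiv.Perm (Fin n) // invCount π = k ∧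
      Avoids π p1324 ∧ Avoids π p1342}, ∃ τ : {π : Equiv.Perm (Fin (n + 1)) // invCount π = k ∧
      Avoids π p1324 ∧ Avoids π p1342}, lehmerCode (n + 1) τ.1 =
        lastNonmax (lehmerCode n π.1) :: shiftNonmax (lehmerCode n π.1) := by
    rintro ⟨π, hk, hπ⟩
    rw [avoids_iff_largerAvoids, largerAvoids_iff_isAvoiderCode] at hπ
    have hs := isAvoiderCode_shiftNonmax hπ
    have hcode : IsAvoiderCode
        (lastNonmax (lehmerCode n π) :: shiftNonmax (lehmerCode n π)) :=
      ⟨hs.1, hs.2, (lastNonmax_le_length hπ).trans (length_shiftNonmax _).ge⟩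
    obtain ⟨τ, hτ⟩ := exists_lehmerCode_eq (n + 1) _
      (by rw [List.length_cons, length_shiftNonmax, length_lehmerCode]) hcode
    refine ⟨⟨τ, ?_, ?_⟩, hτ⟩
    · rw [← sum_lehmerCode, hτ, List.sum_cons, lastNonmax_add_sum_shiftNonmax, sum_lehmerCode, hk]
    · rw [avoids_iff_largerAvoids, largerAvoids_iff_isAvoiderCode, hτ]
      exact hcode
  choose f hf using key
  refine Nat.card_le_card_of_injective f fun π τ e => Subtype.ext (lehmerCode_injective n ?_)
  have hcons := (hf π).symm.trans ((congrArg (fun ρ => lehmerCode (n + 1) ρ.1) e).trans (hf τ))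
  rw [List.cons.injEq] at hcons
  exact eq_of_shiftNonmax_eq
    ((largerAvoids_iff_isAvoiderCode n _).1 ((avoids_iff_largerAvoids _).1 π.2.2))
    ((largerAvoids_iff_isAvoiderCode n _).1 ((avoids_iff_largerAvoids _).1 τ.2.2))
    hcons.2 hcons.1
end
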